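/- arXiv:0912.2532 — 8 statements merged into one kernel-verified Lean document; each statement's English description precedes it below -/
import Mathlib

section
/- Let P be a subset of {1,…,m} with P ≠ {1,…,m}, and let D := ℤ[⟨τ_k : k ∉ P⟩] be the group ring of the subgroup of G generated by the τ_k with k ∉ P, viewed as a subring of Λ. Then the quotient Λ/Λ(P) is a free D-module of rank ∏_{n∈P}(g_n − 1). In particular, Λ/Λ(P) is a free abelian group, hence has no ℤ-torsion. -/
set_option maxHeartbeats 1000000

/-- The norm element `s(H) = Σ_{h ∈ H} h` of a subgroup `H`, in the integral group ring. -/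
noncomputable def sElt {G : Type} [Group G] [Finite G] (H : Subgroup G) :
    MonoidAlgebra ℤ G :=
  letI : Fintype H := Fintype.ofFinite _
  ∑ h : H, MonoidAlgebra.of ℤ G (h : G)

open MonoidAlgebra in
/-- If `I` is the ideal of `R[∏ C i]` generated by the norm elements of the factors, then `R[∏ C i] ⧸ I`
is free over `R`, with basis the classes of the tuples that are nowhere `1`. -/
theorem nonempty_quotient_norms_linearEquiv {R ι : Type*} [CommRing R] [Fintype ι] [DecidableEq ι]
    {C : ι → Type*} [∀ i, CommGroup (C i)] [∀ i, Fintype (C i)] [∀ i, DecidableEq (C i)]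
    (I : Ideal (MonoidAlgebra R (∀ i, C i)))
    (hI : I = Ideal.span (Set.range fun i => ∑ c : C i, single (Pi.mulSingle i c) (1 : R))) :
    Nonempty ((MonoidAlgebra R (∀ i, C i) ⧸ I) ≃ₗ[R] ((∀ i, {c : C i // c ≠ 1}) → R)) := by
  classical
  set w : ∀ i, C i → C i → R := fun i c b => if c = b then 1 else if c = 1 then -1 else 0 with hw
  have hw_sum : ∀ i (b : C i), b ≠ 1 → ∑ c, w i c b = 0 := by
    intro i b hb
    have : ∀ c, w i c b = (if c = b then 1 else 0) + (if c = 1 then -1 else 0) := by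
      intro c
      simp only [hw]
      split_ifs with h1 h2 <;> simp_all
    simp [this, Finset.sum_add_distrib]
  let Φ : MonoidAlgebra R (∀ i, C i) →ₗ[R] ((∀ i, {c : C i // c ≠ 1}) → R) :=
    (Finsupp.lift _ R _ fun k b => ∏ i, w i (k i) (b i)) ∘ₗ (coeffLinearEquiv R).toLinearMap
  have hΦ : ∀ k r b, Φ (single k r) b = r * ∏ i, w i (k i) (b i) := by
    intro k r b
    simp [Φ]
  have hΦI : I.restrictScalars R ≤ LinearMap.ker Φ := by
    intro x hx
    rw [Submodule.restrictScalars_mem, hI] at hx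
    suffices ∀ y, Φ (y * x) = 0 by simpa using this 1
    refine Submodule.span_induction (p := fun x _ => ∀ y, Φ (y * x) = 0) ?_ ?_ ?_ ?_ hx
    · rintro _ ⟨i, rfl⟩ y
      induction y using MonoidAlgebra.induction_linear with
      | zero => simp
      | add f g hf hg => rw [add_mul, map_add, hf, hg, add_zero]
      | single k r =>
        ext b
        rw [Finset.mul_sum, map_sum, Finset.sum_apply]
        simp only [single_mul_single, hΦ, mul_one]
        rw [← Finset.mul_sum]
        have : ∀ c : C i, ∏ j, w j ((k * Pi.mulSingle i c) j) (b j) =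
            w i (k i * c) (b i) * ∏ j ∈ Finset.univ.erase i, w j (k j) (b j) := by
          intro c
          rw [← Finset.mul_prod_erase _ _ (Finset.mem_univ i)]
          congr 1
          · simp
          · refine Finset.prod_congr rfl fun j hj => ?_
            simp [Pi.mulSingle_eq_of_ne (Finset.ne_of_mem_erase hj)]
        simp only [this]
        have hshift : ∑ c, w i (k i * c) (b i) = 0 :=
          (Equiv.sum_comp (Equiv.mulLeft (k i)) fun c => w i c (b i)).trans
            (hw_sum i _ (b i).2)
        rw [← Finset.sum_mul, hshift, zero_mul, mul_zero, Pi.zero_apply]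
    · simp
    · intro x y _ _ hx hy z
      rw [mul_add, map_add, hx, hy, add_zero]
    · intro a x _ hx z
      rw [smul_eq_mul, ← mul_assoc, hx]
  let Φq : (MonoidAlgebra R (∀ i, C i) ⧸ I) →ₗ[R] ((∀ i, {c : C i // c ≠ 1}) → R) :=
    (I.restrictScalars R).liftQ Φ hΦI
  have hΦq : ∀ x, Φq (Ideal.Quotient.mk I x) = Φ x := fun x => rfl
  let Ψ : ((∀ i, {c : C i // c ≠ 1}) → R) →ₗ[R] (MonoidAlgebra R (∀ i, C i) ⧸ I) :=
    Fintype.linearCombination R fun b => Ideal.Quotient.mk I (single (fun i => (b i : C i)) 1)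
  refine ⟨LinearEquiv.ofLinearMap Φq Ψ ?_ ?_⟩
  · refine LinearMap.pi_ext' fun b => LinearMap.ext_ring ?_
    ext b'
    simp only [LinearMap.comp_apply, LinearMap.single_apply, Ψ,
      Fintype.linearCombination_apply_single, one_smul, hΦq, hΦ, LinearMap.id_apply, one_mul]
    by_cases h : b = b'
    · subst h
      simp [hw]
    · obtain ⟨i, hi⟩ := Function.ne_iff.1 h
      rw [Pi.single_apply, if_neg (Ne.symm h)]
      refine Finset.prod_eq_zero (Finset.mem_univ i) ?_
      simp only [hw]
      rw [if_neg (fun h => hi (Subtype.ext h)), if_neg (b i).2]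
  · set q := Ideal.Quotient.mk I
    let u : ∀ i, C i → MonoidAlgebra R (∀ i, C i) := fun i c => single (Pi.mulSingle i c) 1
    have hu : ∀ k : ∀ i, C i, single k (1 : R) = ∏ i, u i (k i) := by
      intro k
      have := map_prod (MonoidAlgebra.of R (∀ i, C i)) (fun i => Pi.mulSingle i (k i)) Finset.univ
      rw [Finset.univ_prod_mulSingle] at this
      simpa [u] using this
    have hus : ∀ i, ∑ c, q (u i c) = 0 := by
      intro i
      rw [← map_sum]
      refine Ideal.Quotient.eq_zero_iff_mem.2 ?_
      rw [hI]
      exact Ideal.subset_span ⟨i, rfl⟩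
    have huw : ∀ i c, q (u i c) = ∑ b : {c : C i // c ≠ 1}, w i c b • q (u i b) := by
      intro i c
      by_cases hc : c = 1
      · subst hc
        have h1 := hus i
        rw [Fintype.sum_eq_add_sum_subtype_ne _ (1 : C i)] at h1
        rw [eq_neg_of_add_eq_zero_left h1, ← Finset.sum_neg_distrib]
        refine Finset.sum_congr rfl fun b _ => ?_
        simp [hw, Ne.symm b.2]
      · rw [Finset.sum_eq_single ⟨c, hc⟩]
        · simp [hw]
        · intro b _ hb
          have : c ≠ b := fun h => hb (Subtype.ext h.symm)
          simp [hw, this, hc]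
        · simp
    refine LinearMap.ext fun x => ?_
    obtain ⟨x, rfl⟩ := Ideal.Quotient.mk_surjective x
    rw [LinearMap.comp_apply, hΦq, LinearMap.id_apply]
    induction x using MonoidAlgebra.induction_linear with
    | zero => simp
    | add f g hf hg => rw [map_add, map_add, map_add, hf, hg]
    | single k r =>
      have hr : single k r = r • single k (1 : R) := by rw [smul_single, smul_eq_mul, mul_one]
      have hq : ∀ (r : R) x, Ideal.Quotient.mk I (r • x) = r • Ideal.Quotient.mk I x :=
        fun _ _ => rfl
      rw [hr, map_smul, map_smul, hq]
      congr 1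
      have : ∀ b, Φ (single k 1) b = ∏ i, w i (k i) (b i) := fun b => by rw [hΦ, one_mul]
      simp only [Ψ, Fintype.linearCombination_apply, this]
      change _ = q _
      rw [hu k, map_prod]
      rw [Finset.prod_congr rfl fun i _ => huw i (k i), Fintype.prod_sum]
      refine Finset.sum_congr rfl fun b _ => ?_
      rw [hu, map_prod, Finset.prod_smul]

/-- Two complementary families of independent subgroups: the group is the direct product of
the factors indexed by `P` and of the subgroup generated by the others. -/
theorem bijective_noncommPiCoprod_coprod {G ι : Type*} [CommGroup G] [Fintype ι]
    (H : ι → Subgroup G) (hindep : iSupIndep H) (hgen : ⨆ i, H i = ⊤)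
    (P : Finset ι) (D : Subgroup G) (hD : D = ⨆ i ∉ P, H i)
    (hcomm : Pairwise fun i j : P => ∀ x y : G, x ∈ H i → y ∈ H j → Commute x y) :
    Function.Bijective ((Subgroup.noncommPiCoprod hcomm).coprod D.subtype) := by
  classical
  have hP : (⨆ i : P, H i) = ⨆ i ∈ P, H i := by rw [iSup_subtype']
  have hdisj : Disjoint (⨆ i ∈ P, H i) D := by
    rw [hD]
    exact hindep.disjoint_biSup_biSup' (s := {i | i ∈ P}) (t := {i | i ∉ P})
      (Set.disjoint_left.2 fun _ h h' => h' h) (Set.toFinite _)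
  constructor
  · rw [injective_iff_map_eq_one]
    rintro ⟨k, d⟩ h
    rw [MonoidHom.coprod_apply] at h
    have hk := (MonoidHom.mem_range (f := Subgroup.noncommPiCoprod hcomm)).2 ⟨k, rfl⟩
    rw [Subgroup.noncommPiCoprod_range, hP] at hk
    have hd : (d : G) = 1 := by
      refine Subgroup.disjoint_def.1 hdisj ?_ d.2
      rw [← inv_mem_iff]
      exact (eq_inv_of_mul_eq_one_left h) ▸ hk
    rw [Subgroup.coe_subtype, hd, mul_one] at h
    have hk1 := (injective_iff_map_eq_one _).1
      (Subgroup.injective_noncommPiCoprod_of_iSupIndep (H := fun i : P => H i)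
        (hind := hindep.comp Subtype.val_injective)) k h
    exact Prod.ext hk1 (Subtype.ext hd)
  · rw [← MonoidHom.range_eq_top, eq_top_iff, ← hgen]
    refine iSup_le fun i x hx => ?_
    by_cases hi : i ∈ P
    · refine ⟨(Pi.mulSingle ⟨i, hi⟩ ⟨x, hx⟩, 1), ?_⟩
      rw [MonoidHom.coprod_apply, Subgroup.noncommPiCoprod_mulSingle, map_one, mul_one]
    · refine ⟨(1, ⟨x, hD ▸ Subgroup.mem_iSup_of_mem i (Subgroup.mem_iSup_of_mem hi hx)⟩), ?_⟩
      rw [MonoidHom.coprod_apply, map_one, one_mul, Subgroup.coe_subtype]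

/-- Let `G = ⟨τ_1⟩ × ⋯ × ⟨τ_m⟩` be an internal direct product of cyclic groups, `τ_i` of
order `g_i`, `Λ = ℤ[G]`, and for `P ⊆ {1,…,m}` let `Λ(P)` be the ideal generated by the
`s(⟨τ_i⟩)`, `i ∈ P`.  If `P ≠ {1,…,m}` then `Λ/Λ(P)` is a free module of rank
`∏_{n ∈ P} (g_n - 1)` over `D = ℤ[⟨τ_k : k ∉ P⟩]`; in particular it is a free abelian
group, hence has no `ℤ`-torsion. -/
theorem stmt_0 {G : Type} [CommGroup G] [Fintype G]
    (m : ℕ) (τ : Fin m → G) (g : Fin m → ℕ)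
    (hord : ∀ i, orderOf (τ i) = g i)
    (hindep : iSupIndep fun i => Subgroup.zpowers (τ i))
    (hgen : (⨆ i, Subgroup.zpowers (τ i)) = ⊤)
    (P : Finset (Fin m)) (hP : P ≠ Finset.univ)
    (D : Subgroup G) (hD : D = Subgroup.closure (τ '' {k | k ∉ P}))
    (ΛP : Ideal (MonoidAlgebra ℤ G))
    (hΛP : ΛP = Ideal.span ((fun i => sElt (Subgroup.zpowers (τ i))) '' (P : Set (Fin m)))) :
    letI : Module (MonoidAlgebra ℤ D) (MonoidAlgebra ℤ G ⧸ ΛP) :=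
      Module.compHom _ (MonoidAlgebra.mapDomainRingHom ℤ D.subtype)
    (Module.Free (MonoidAlgebra ℤ D) (MonoidAlgebra ℤ G ⧸ ΛP) ∧
      Module.finrank (MonoidAlgebra ℤ D) (MonoidAlgebra ℤ G ⧸ ΛP) = ∏ i ∈ P, (g i - 1)) ∧
    Module.Free ℤ (MonoidAlgebra ℤ G ⧸ ΛP) ∧
    ∀ (x : MonoidAlgebra ℤ G ⧸ ΛP) (n : ℤ), n ≠ 0 → n • x = 0 → x = 0 := by
  classical
  let _ : Module (MonoidAlgebra ℤ D) (MonoidAlgebra ℤ G ⧸ ΛP) :=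
    Module.compHom _ (MonoidAlgebra.mapDomainRingHom ℤ D.subtype)
  let C : P → Subgroup G := fun i => Subgroup.zpowers (τ i)
  let _ : ∀ i, Fintype (C i) := fun i => Fintype.ofFinite _
  have hcomm : Pairwise fun i j : P => ∀ x y : G, x ∈ C i → y ∈ C j → Commute x y :=
    fun _ _ _ x y _ _ => Commute.all x y
  have hbij := bijective_noncommPiCoprod_coprod (fun i => Subgroup.zpowers (τ i)) hindep hgen P D
    (by
      rw [hD]
      refine le_antisymm ((Subgroup.closure_le _).2 ?_) (iSup₂_le fun i hi => ?_)
      · rintro _ ⟨i, hi, rfl⟩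
        exact Subgroup.mem_iSup_of_mem i
          (Subgroup.mem_iSup_of_mem hi (Subgroup.mem_zpowers (τ i)))
      · exact Subgroup.zpowers_le.2 (Subgroup.subset_closure ⟨i, hi, rfl⟩)) hcomm
  let e : ((∀ i, C i) × D) ≃* G := MulEquiv.ofBijective _ hbij
  have he : ∀ k d, e (k, d) = Subgroup.noncommPiCoprod hcomm k * d := fun k d => rfl
  let F : MonoidAlgebra (MonoidAlgebra ℤ D) (∀ i, C i) ≃+* MonoidAlgebra ℤ G :=
    MonoidAlgebra.curryRingEquiv.symm.trans (MonoidAlgebra.mapDomainRingEquiv ℤ e)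
  have hF : ∀ k d n, F (.single k (.single d n)) = .single (e (k, d)) n := by
    intro k d n
    simp [F]
  have hF_algebraMap : ∀ r, F (algebraMap _ _ r) = MonoidAlgebra.mapDomainRingHom ℤ D.subtype r := by
    intro r
    induction r using MonoidAlgebra.induction_linear with
    | zero => simp
    | add f g hf hg => rw [map_add, map_add, map_add, hf, hg]
    | single d n =>
      rw [MonoidAlgebra.coe_algebraMap]
      simp [hF, he]
  have hF_norm : ∀ i, F (∑ c : C i, .single (Pi.mulSingle i c) 1) =
      sElt (Subgroup.zpowers (τ i)) := by
    intro i
    rw [map_sum, sElt]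
    refine Finset.sum_congr rfl fun c _ => ?_
    rw [MonoidAlgebra.one_def, hF, he, Subgroup.noncommPiCoprod_mulSingle]
    simp
  obtain ⟨φ⟩ := nonempty_quotient_norms_linearEquiv (R := MonoidAlgebra ℤ D) (C := fun i => C i) _ rfl
  have hmap : ΛP = Ideal.map (F : MonoidAlgebra (MonoidAlgebra ℤ D) (∀ i, C i) →+* MonoidAlgebra ℤ G)
      (Ideal.span (Set.range fun i => ∑ c : C i,
        MonoidAlgebra.single (Pi.mulSingle i c) (1 : MonoidAlgebra ℤ D))) := by
    rw [Ideal.map_span, hΛP, ← Set.range_comp, Set.image_eq_range]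
    congr 2
    funext i
    exact (hF_norm i).symm
  let ψ := (Ideal.quotientEquiv _ ΛP F hmap).symm
  let θ : (MonoidAlgebra ℤ G ⧸ ΛP) ≃ₗ[MonoidAlgebra ℤ D]
      ((∀ i, {c : C i // c ≠ 1}) → MonoidAlgebra ℤ D) :=
    { ψ.toAddEquiv.trans φ.toAddEquiv with
      map_smul' := by
        intro r x
        change φ (ψ (Ideal.Quotient.mk ΛP (MonoidAlgebra.mapDomainRingHom ℤ D.subtype r) * x)) =
          r • φ (ψ x)
        rw [← map_smul φ, map_mul, ← hF_algebraMap, Ideal.quotientEquiv_symm_mk,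
          F.symm_apply_apply]
        exact (congrArg φ (Algebra.smul_def r (ψ x))).symm }
  have hfree : Module.Free ℤ (MonoidAlgebra ℤ G ⧸ ΛP) :=
    Module.Free.of_equiv θ.toAddEquiv.toIntLinearEquiv.symm
  refine ⟨⟨Module.Free.of_equiv θ.symm, ?_⟩, hfree, ?_⟩
  · rw [θ.finrank_eq, Module.finrank_fintype_fun_eq_card, Fintype.card_pi, ← Finset.prod_coe_sort P]
    refine Finset.prod_congr rfl fun i _ => ?_
    rw [Fintype.card_subtype_compl, Fintype.card_subtype_eq, ← Nat.card_eq_fintype_card,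
      Nat.card_zpowers, hord]
  · intro x n hn hx
    exact (smul_eq_zero.1 hx).resolve_left hn
end

section
/- Let P ⊊ Q be two subsets of {1,…,m−1} with P strictly contained in Q, and let D_Q be the subgroup of G generated by j together with the elements τ_i for i ∈ {1,…,m−1} ∖ Q. Let D_Q act on Λ/Λ(P) by left multiplication. Then the group cohomology H^k(D_Q, Λ/Λ(P)) vanishes for every k ≥ 1. -/
set_option maxHeartbeats 1000000

/-- The representation of a subgroup `D ≤ G` on the quotient of `ℤ[G]` by an ideal `I`,
where `D` acts by left multiplication. -/
noncomputable def quotRep {G : Type} [CommGroup G] (I : Ideal (MonoidAlgebra ℤ G))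
    (D : Subgroup G) : Representation ℤ D (MonoidAlgebra ℤ G ⧸ I) :=
  (((Algebra.lmul ℤ (MonoidAlgebra ℤ G ⧸ I)).toRingHom.toMonoidHom).comp
    ((Ideal.Quotient.mk I).toMonoidHom)).comp
    ((MonoidAlgebra.of ℤ G).comp D.subtype)

open CategoryTheory in
/-- A representation `ρ` of a finite group whose identity is the trace `∑ d, d⁻¹ θ d` of a linear
endomorphism `θ` is a direct summand of a coinduced module, so it has no higher cohomology. -/
theorem groupCohomology.subsingleton_of_sum_conj_eq {k D V : Type} [CommRing k] [Group D]
    [Fintype D] [AddCommGroup V] [Module k V] (ρ : Representation k D V) (θ : V →ₗ[k] V)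
    (hθ : ∀ v, ∑ d : D, ρ d⁻¹ (θ (ρ d v)) = v) (n : ℕ) (hn : 1 ≤ n) :
    Subsingleton (groupCohomology (Rep.of ρ) n) := by
  let A : Rep k (⊥ : Subgroup D) := Rep.of (Representation.trivial k (⊥ : Subgroup D) V)
  let C : Rep k D := Rep.coind (⊥ : Subgroup D).subtype A
  let ι : Rep.of ρ ⟶ C := Rep.ofHom (LinearMap.intertwiningMap_of_isIntertwiningMap ρ C.ρ
    (LinearMap.codRestrict _ (LinearMap.pi fun d => θ ∘ₗ ρ d) fun v s h => by
      obtain ⟨s, hs⟩ := s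
      obtain rfl := Subgroup.mem_bot.1 hs
      simp [A])
    fun d v => by
      refine Subtype.ext (funext fun x => ?_)
      change θ (ρ x (ρ d v)) = θ (ρ (x * d) v)
      rw [map_mul]; rfl)
  let π : C ⟶ Rep.of ρ := Rep.ofHom (LinearMap.intertwiningMap_of_isIntertwiningMap C.ρ ρ
    ((∑ d : D, ρ d⁻¹ ∘ₗ LinearMap.proj d) ∘ₗ Submodule.subtype _) fun e f => by
      simp only [LinearMap.comp_apply, LinearMap.sum_apply, map_sum]
      refine Fintype.sum_equiv (Equiv.mulRight e) _ _ fun d => ?_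
      change ρ d⁻¹ (f.1 (d * e)) = ρ e (ρ (d * e)⁻¹ (f.1 (d * e)))
      rw [← Module.End.mul_apply, ← map_mul]
      simp)
  have hιπ : ι ≫ π = 𝟙 (Rep.of ρ) := by
    refine Rep.hom_ext (Representation.IntertwiningMap.ext (LinearMap.ext fun v => ?_))
    refine Eq.trans ?_ (hθ v)
    change (∑ d : D, ρ d⁻¹ ∘ₗ LinearMap.proj d) (fun d => θ (ρ d v)) = _
    simp
  have hC : Limits.IsZero ((groupCohomology.functor k D n).obj C) := by
    obtain ⟨n, rfl⟩ := Nat.exists_eq_add_of_le' hn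
    exact (isZero_groupCohomology_succ_of_subsingleton A n).of_iso (coindIso A (n + 1))
  have hzero : Limits.IsZero ((groupCohomology.functor k D n).obj (Rep.of ρ)) := by
    rw [Limits.IsZero.iff_id_eq_zero, ← CategoryTheory.Functor.map_id, ← hιπ, Functor.map_comp,
      hC.eq_of_tgt ((groupCohomology.functor k D n).map ι) 0, Limits.zero_comp]
  exact ModuleCat.subsingleton_of_isZero hzero

/-- The `R`-linear projection of `R[G]` onto the span of a set `S` of group elements. -/
noncomputable def MonoidAlgebra.projOn {R G : Type*} [CommRing R] (S : Set G) :
    MonoidAlgebra R G →ₗ[R] MonoidAlgebra R G :=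
  open scoped Classical in
  (MonoidAlgebra.coeffLinearEquiv R).symm.toLinearMap ∘ₗ
    Finsupp.lsum R (fun g => if g ∈ S then Finsupp.lsingle g else 0) ∘ₗ
      (MonoidAlgebra.coeffLinearEquiv R).toLinearMap

open scoped Classical in
theorem MonoidAlgebra.projOn_of {R G : Type*} [CommRing R] [Monoid G] (S : Set G) (g : G) :
    projOn S (of R G g) = if g ∈ S then of R G g else 0 := by
  split_ifs with h <;> simp [projOn, of_apply, h]

theorem MonoidAlgebra.linearMap_ext_of {R G M : Type*} [CommRing R] [Monoid G] [AddCommGroup M]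
    [Module R M] {f f' : MonoidAlgebra R G →ₗ[R] M} (h : ∀ g, f (of R G g) = f' (of R G g)) :
    f = f' := by
  ext g
  simpa using h g

theorem MonoidAlgebra.projOn_of_mul {R G : Type*} [CommRing R] [Group G] {S : Set G} {t : G}
    (ht : ∀ g, t * g ∈ S ↔ g ∈ S) (x : MonoidAlgebra R G) :
    projOn S (of R G t * x) = of R G t * projOn S x := by
  classical
  suffices projOn S ∘ₗ LinearMap.mulLeft R (of R G t) =
      LinearMap.mulLeft R (of R G t) ∘ₗ projOn S from LinearMap.congr_fun this x
  refine linearMap_ext_of fun g => ?_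
  simp only [LinearMap.comp_apply, LinearMap.mulLeft_apply, ← map_mul, projOn_of, mul_ite,
    mul_zero]
  convert if_congr (ht g) rfl rfl

theorem Ideal.apply_mem_span_of_map_mul {R A : Type*} [CommRing R] [CommRing A] [Algebra R A]
    (θ : A →ₗ[R] A) {s : Set A} (hs : ∀ a ∈ s, ∀ x, θ (a * x) = a * θ x) {x : A}
    (hx : x ∈ Ideal.span s) : θ x ∈ Ideal.span s := by
  suffices ∀ y, θ (y * x) ∈ Ideal.span s by simpa using this 1
  induction hx using Submodule.span_induction with
  | mem a ha =>
    intro y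
    rw [mul_comm, hs a ha]
    exact Ideal.mul_mem_right _ _ (Ideal.subset_span ha)
  | zero => simp
  | add a b _ _ iha ihb => intro y; rw [mul_add, map_add]; exact add_mem (iha y) (ihb y)
  | smul c a _ ih => intro y; rw [smul_eq_mul, ← mul_assoc]; exact ih _

/-- Disjoint subgroups `D` and `T` admit a `T`-stable set of representatives modulo `D`. -/
theorem Subgroup.exists_stable_transversal {G : Type*} [CommGroup G] {D T : Subgroup G}
    (h : Disjoint D T) : ∃ S : Set G, (∀ t ∈ T, ∀ g, t * g ∈ S ↔ g ∈ S) ∧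
      ∀ g, ∃! d : D, (d : G) * g ∈ S := by
  let σ : G → G := fun g => (QuotientGroup.mk g : G ⧸ D ⊔ T).out
  have hσ (x g : G) (hx : x ∈ D ⊔ T) : σ (x * g) = σ g := by
    refine congrArg Quotient.out (QuotientGroup.eq.2 ?_)
    simpa using hx
  refine ⟨{g | g * (σ g)⁻¹ ∈ T}, fun t ht g => ?_, fun g => ?_⟩
  · simp only [Set.mem_ofPred_eq, hσ t g (mem_sup_right ht), mul_assoc]
    exact T.mul_mem_cancel_left ht
  · have hmem : g * (σ g)⁻¹ ∈ D ⊔ T := by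
      rw [mul_comm]
      exact QuotientGroup.eq.1 (Quotient.out_eq (QuotientGroup.mk g : G ⧸ D ⊔ T))
    obtain ⟨d, hd, t, ht, hdt⟩ := mem_sup.1 hmem
    have key (e : D) : (e : G) * g * (σ (e * g))⁻¹ = e * d * t := by
      rw [hσ _ _ (mem_sup_left e.2), mul_assoc, ← hdt, mul_assoc]
    refine ⟨⟨d⁻¹, inv_mem hd⟩, ?_, fun e he => ?_⟩
    · change (d⁻¹ * g) * (σ (d⁻¹ * g))⁻¹ ∈ T
      rw [key ⟨d⁻¹, inv_mem hd⟩]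
      simpa using ht
    · change e * g * (σ (e * g))⁻¹ ∈ T at he
      rw [key, T.mul_mem_cancel_right ht] at he
      exact Subtype.ext (eq_inv_of_mul_eq_one_left
        (Subgroup.disjoint_def.1 h (mul_mem e.2 hd) he))

/-- If the ideal `I` of `ℤ[G]` is generated by elements of `ℤ[T]` and the subgroups `D` and `T`
are disjoint, then `ℤ[G] ⧸ I` has no higher `D`-cohomology. -/
theorem subsingleton_groupCohomology_quotRep {G : Type} [CommGroup G] [Finite G]
    {D T : Subgroup G} (h : Disjoint D T) (s : Set (MonoidAlgebra ℤ G))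
    (hs : ∀ a ∈ s, a ∈ Submodule.span ℤ (MonoidAlgebra.of ℤ G '' (T : Set G)))
    (n : ℕ) (hn : 1 ≤ n) :
    Subsingleton (groupCohomology (Rep.of (quotRep (Ideal.span s) D)) n) := by
  classical
  have : Fintype D := Fintype.ofFinite D
  obtain ⟨S, hST, hSD⟩ := Subgroup.exists_stable_transversal h
  let θ := MonoidAlgebra.projOn (R := ℤ) S
  have hθs : ∀ a ∈ s, ∀ x, θ (a * x) = a * θ x := by
    intro a ha x
    have has := hs a ha
    clear ha
    induction has using Submodule.span_induction with
    | mem a ha =>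
      obtain ⟨t, ht, rfl⟩ := ha
      exact MonoidAlgebra.projOn_of_mul (hST t ht) x
    | zero => simp
    | add a b _ _ iha ihb => rw [add_mul, map_add, iha, ihb, add_mul]
    | smul c a _ ih => rw [smul_mul_assoc, map_smul, ih, smul_mul_assoc]
  have hθ (x : MonoidAlgebra ℤ G) :
      ∑ d : D, MonoidAlgebra.of ℤ G (d⁻¹ : D) * θ (MonoidAlgebra.of ℤ G d * x) = x := by
    suffices ∑ d : D, LinearMap.mulLeft ℤ (MonoidAlgebra.of ℤ G (d⁻¹ : D)) ∘ₗ θ ∘ₗ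
        LinearMap.mulLeft ℤ (MonoidAlgebra.of ℤ G d) = LinearMap.id by
      simpa using LinearMap.congr_fun this x
    refine MonoidAlgebra.linearMap_ext_of fun g => ?_
    obtain ⟨d, hd, hd'⟩ := hSD g
    rw [LinearMap.sum_apply, Finset.sum_eq_single d]
    · simp only [LinearMap.comp_apply, LinearMap.mulLeft_apply, ← map_mul, θ,
        MonoidAlgebra.projOn_of, if_pos hd]
      simp
    · intro e _ hed
      simp only [LinearMap.comp_apply, LinearMap.mulLeft_apply, ← map_mul, θ,
        MonoidAlgebra.projOn_of, if_neg fun he => hed (hd' e he), mul_zero]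
    · simp
  let I := Ideal.span s
  let θI : (MonoidAlgebra ℤ G ⧸ I) →ₗ[ℤ] (MonoidAlgebra ℤ G ⧸ I) :=
    (QuotientAddGroup.map I.toAddSubgroup I.toAddSubgroup θ.toAddMonoidHom
      fun x hx => Ideal.apply_mem_span_of_map_mul θ hθs hx).toIntLinearMap
  refine groupCohomology.subsingleton_of_sum_conj_eq _ θI (fun v => ?_) n hn
  obtain ⟨x, rfl⟩ := Ideal.Quotient.mk_surjective v
  refine Eq.trans ?_ (congrArg (Ideal.Quotient.mk I) (hθ x))
  rw [map_sum]
  rfl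

theorem sElt_mem_span {G : Type} [Group G] [Finite G] {H T : Subgroup G} (h : H ≤ T) :
    sElt H ∈ Submodule.span ℤ (MonoidAlgebra.of ℤ G '' (T : Set G)) :=
  sum_mem fun x _ => Submodule.subset_span ⟨x, h x.2, rfl⟩

theorem Subgroup.exists_zpow_of_mem_closure_image {G ι : Type*} [CommGroup G] [Fintype ι]
    (τ : ι → G) (s : Set ι) {x : G} (hx : x ∈ closure (τ '' s)) :
    ∃ c : ι → ℤ, (∀ i ∉ s, c i = 0) ∧ x = ∏ i, τ i ^ c i := by
  classical
  induction hx using closure_induction with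
  | mem x hx =>
    obtain ⟨i, hi, rfl⟩ := hx
    refine ⟨Pi.single i 1, fun k hk => Pi.single_eq_of_ne (by rintro rfl; exact hk hi) _, ?_⟩
    rw [Finset.prod_eq_single i] <;> simp +contextual
  | one => exact ⟨0, by simp⟩
  | mul x y _ _ hx hy =>
    obtain ⟨a, ha, rfl⟩ := hx
    obtain ⟨b, hb, rfl⟩ := hy
    exact ⟨a + b, fun i hi => by simp [ha i hi, hb i hi], by
      simp [zpow_add, Finset.prod_mul_distrib]⟩
  | inv x _ hx =>
    obtain ⟨a, ha, rfl⟩ := hx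
    exact ⟨-a, fun i hi => by simp [ha i hi], by simp⟩

theorem iSupIndep.zpow_eq_one {G ι : Type*} [CommGroup G] [Fintype ι] {τ : ι → G}
    (h : iSupIndep fun i => Subgroup.zpowers (τ i)) {c : ι → ℤ} (hc : ∏ i, τ i ^ c i = 1)
    (i : ι) : τ i ^ c i = 1 := by
  refine Subgroup.eq_one_of_noncommProd_eq_one_of_iSupIndep Finset.univ (fun i => τ i ^ c i)
    (fun _ _ _ _ _ => Commute.all _ _) _ h (fun i _ => ⟨c i, rfl⟩) ?_ i (Finset.mem_univ i)
  rwa [Finset.noncommProd_eq_prod]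

/-- A subgroup generated by `∏ i, τ i ^ e i` and by elements `τ i`, `i ∈ s`, meets the subgroup
generated by the `τ i`, `i ∈ p`, trivially, if some coordinate outside `s ∪ p` detects enough of
the exponent of `∏ i, τ i ^ e i`. -/
theorem Subgroup.disjoint_closure_of_iSupIndep {G ι : Type*} [CommGroup G] [Fintype ι]
    {τ : ι → G} (h : iSupIndep fun i => zpowers (τ i)) {e : ι → ℕ} {s p : Set ι} {q : ι}
    (hsp : Disjoint s p) (hqs : q ∉ s) (hqp : q ∉ p)
    (hq : ∀ n : ℤ, (τ q ^ e q) ^ n = 1 → ∀ i ∈ p, (τ i ^ e i) ^ n = 1) :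
    Disjoint (closure ({∏ i, τ i ^ e i} ∪ τ '' s)) (closure (τ '' p)) := by
  rw [Subgroup.disjoint_def]
  intro x hx hxp
  obtain ⟨b, hb, hxb⟩ := exists_zpow_of_mem_closure_image τ p hxp
  rw [closure_union] at hx
  obtain ⟨y, hy, z, hz, hyz⟩ := mem_sup.1 hx
  obtain ⟨n, rfl⟩ := mem_closure_singleton.1 hy
  obtain ⟨c, hc, rfl⟩ := exists_zpow_of_mem_closure_image τ s hz
  have key := h.zpow_eq_one (c := fun i => e i * n + c i - b i) (by
    simp only [zpow_sub, zpow_add, zpow_mul, zpow_natCast, Finset.prod_mul_distrib,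
      Finset.prod_inv_distrib, Finset.prod_zpow, hyz, ← hxb, mul_inv_cancel])
  have hqn := key q
  simp only [hc q hqs, hb q hqp, add_zero, sub_zero, zpow_mul, zpow_natCast] at hqn
  rw [hxb]
  refine Finset.prod_eq_one fun i _ => ?_
  by_cases hi : i ∈ p
  · have hik := key i
    simpa [hc i (hsp.notMem_of_mem_right hi), zpow_sub, zpow_mul, hq n hqn i hi] using hik
  · simp [hb i hi]

/-- Proposition (vanishing of cohomology): with `G` the internal direct product of the
cyclic groups `⟨τ_1⟩, …, ⟨τ_m⟩` (orders `g_1, …, g_{m-1}, g_m/ℓ^r`, all `g_i` powers of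
the prime `ℓ`, `ℓ^r ∣ g_m ≤ g_i`), `j = τ_1^{g_1/g_m} ⋯ τ_{m-1}^{g_{m-1}/g_m} τ_m`, and
`P ⊊ Q ⊆ {1,…,m-1}`, let `D_Q` be the subgroup generated by `j` and the `τ_i`,
`i ∈ {1,…,m-1} ∖ Q`, acting by left multiplication on `Λ/Λ(P)`.  Then
`H^k(D_Q, Λ/Λ(P)) = 0` for all `k ≥ 1`. -/
theorem stmt_1 {G : Type} [CommGroup G] [Fintype G]
    (ℓ m r : ℕ) (hℓ : ℓ.Prime) (hm : 2 ≤ m)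
    (τ : Fin m → G) (g : Fin m → ℕ)
    (lst : Fin m) (hlst : (lst : ℕ) = m - 1)
    (hpow : ∀ i, ∃ k, g i = ℓ ^ k)
    (hdvd : ℓ ^ r ∣ g lst)
    (hle : ∀ i, g lst ≤ g i)
    (hord : ∀ i, i ≠ lst → orderOf (τ i) = g i)
    (hordlst : orderOf (τ lst) = g lst / ℓ ^ r)
    (hindep : iSupIndep fun i => Subgroup.zpowers (τ i))
    (hgen : (⨆ i, Subgroup.zpowers (τ i)) = ⊤)
    (j : G) (hj : j = ∏ i, τ i ^ (g i / g lst))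
    (P Q : Finset (Fin m)) (hQ : lst ∉ Q) (hPQ : P ⊂ Q)
    (DQ : Subgroup G)
    (hDQ : DQ = Subgroup.closure ({j} ∪ τ '' {i | i ≠ lst ∧ i ∉ Q}))
    (ΛP : Ideal (MonoidAlgebra ℤ G))
    (hΛP : ΛP = Ideal.span ((fun i => sElt (Subgroup.zpowers (τ i))) '' (P : Set (Fin m)))) :
    ∀ k : ℕ, 1 ≤ k → Subsingleton (groupCohomology (Rep.of (quotRep ΛP DQ)) k) := by
  subst hj hDQ hΛP
  obtain ⟨q, hqQ, hqP⟩ := Finset.exists_of_ssubset hPQ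
  have hne (i : Fin m) (hi : i ∈ Q) : i ≠ lst := by rintro rfl; exact hQ hi
  have hpos : 0 < g lst := by
    obtain ⟨k, hk⟩ := hpow lst
    exact hk ▸ pow_pos hℓ.pos k
  have hdiv (i : Fin m) : g lst * (g i / g lst) = g i := by
    refine Nat.mul_div_cancel' ?_
    obtain ⟨a, ha⟩ := hpow lst
    obtain ⟨b, hb⟩ := hpow i
    have hab := hle i
    rw [ha, hb] at hab ⊢
    exact pow_dvd_pow ℓ ((Nat.pow_le_pow_iff_right hℓ.one_lt).1 hab)
  have horder (i : Fin m) (hi : i ∈ Q) : orderOf (τ i ^ (g i / g lst)) = g lst := by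
    have hgi : 0 < g i := hpos.trans_le (hle i)
    have hdvd' : g i / g lst ∣ g i := ⟨g lst, by rw [mul_comm, hdiv]⟩
    have hne0 : g i / g lst ≠ 0 := (Nat.div_pos (hle i) hpos).ne'
    rw [orderOf_pow_of_dvd hne0 (by rwa [hord i (hne i hi)]), hord i (hne i hi)]
    exact Nat.div_eq_of_eq_mul_left (Nat.pos_of_ne_zero hne0) (hdiv i).symm
  refine subsingleton_groupCohomology_quotRep
    (Subgroup.disjoint_closure_of_iSupIndep hindep (p := (P : Set (Fin m))) (q := q)
      (Set.disjoint_left.2 fun i hi hiP => hi.2 (hPQ.1 hiP)) (fun hq => hq.2 hqQ) hqP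
      fun n hn i hi => ?_) _ ?_
  · rw [← orderOf_dvd_iff_zpow_eq_one, horder _ hqQ] at hn
    rwa [← orderOf_dvd_iff_zpow_eq_one, horder i (hPQ.1 hi)]
  · rintro _ ⟨i, hi, rfl⟩
    exact sElt_mem_span (Subgroup.zpowers_le.2 (Subgroup.subset_closure ⟨i, hi, rfl⟩))
end

section
/- Let P ⊆ {1,…,m−1} and let Θ denote the ideal Λ(P) + s(⟨j⟩)·Λ of Λ. Then the torsion subgroup of the abelian group Λ/Θ is isomorphic to the group cohomology H²(⟨j⟩, Λ/Λ(P)), where the cyclic group ⟨j⟩ acts on Λ/Λ(P) by left multiplication. -/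
set_option maxHeartbeats 1000000

open scoped Classical in
/-- The `ℤ`-linear endomorphism of `ℤ[G]` that keeps the coefficients at the elements of `K` and
sets all the others to zero. -/
noncomputable def restrictSupport {G : Type} [Group G] (K : Subgroup G) :
    MonoidAlgebra ℤ G →ₗ[ℤ] MonoidAlgebra ℤ G :=
  (Finsupp.linearCombination ℤ fun h : G => if h ∈ K then MonoidAlgebra.of ℤ G h else 0) ∘ₗ
    (MonoidAlgebra.coeffLinearEquiv ℤ).toLinearMap

open scoped Classical in
lemma restrictSupport_of {G : Type} [Group G] (K : Subgroup G) (h : G) :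
    restrictSupport K (MonoidAlgebra.of ℤ G h) = if h ∈ K then MonoidAlgebra.of ℤ G h else 0 := by
  simp [restrictSupport]

lemma restrictSupport_of_mul {G : Type} [Group G] (K : Subgroup G) {k : G} (hk : k ∈ K)
    (x : MonoidAlgebra ℤ G) :
    restrictSupport K (MonoidAlgebra.of ℤ G k * x) =
      MonoidAlgebra.of ℤ G k * restrictSupport K x := by
  induction x using MonoidAlgebra.induction_on with
  | of h =>
    rw [← map_mul, restrictSupport_of, restrictSupport_of]
    by_cases hh : h ∈ K
    · rw [if_pos hh, if_pos (K.mul_mem hk hh), map_mul]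
    · rw [if_neg hh, if_neg (mt (K.mul_mem_cancel_left hk).1 hh), mul_zero]
  | add x y hx hy => simp only [mul_add, map_add, hx, hy]
  | smul r x hx => simp only [mul_smul_comm, map_smul, hx]

lemma sElt_mul_of_mem {G : Type} [Group G] [Finite G] (H : Subgroup G) {c : G} (hc : c ∈ H) :
    sElt H * MonoidAlgebra.of ℤ G c = sElt H := by
  let _ : Fintype H := Fintype.ofFinite _
  rw [sElt, Finset.sum_mul]
  exact Fintype.sum_equiv (Equiv.mulRight (⟨c, hc⟩ : H)) _ _ fun h => by simp

lemma restrictSupport_sElt {G : Type} [Group G] [Finite G] {C K : Subgroup G}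
    (hCK : Disjoint C K) : restrictSupport K (sElt C) = 1 := by
  classical
  rw [sElt, map_sum, Finset.sum_eq_single 1]
  · rw [restrictSupport_of, OneMemClass.coe_one, if_pos K.one_mem, map_one]
  · intro c _ hc
    rw [restrictSupport_of, if_neg]
    exact fun hcK => hc (Subtype.ext (Subgroup.disjoint_def.1 hCK c.2 hcK))
  · simp

lemma sElt_mul_restrictSupport {G : Type} [CommGroup G] [Finite G] {C K : Subgroup G}
    (hCK : IsCompl C K) (x : MonoidAlgebra ℤ G) :
    sElt C * restrictSupport K (sElt C * x) = sElt C * x := by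
  induction x using MonoidAlgebra.induction_on with
  | of h =>
    obtain ⟨c, hc, k, hk, rfl⟩ := Subgroup.mem_sup.1 (hCK.sup_eq_top ▸ Subgroup.mem_top h)
    rw [map_mul (MonoidAlgebra.of ℤ G), ← mul_assoc, sElt_mul_of_mem C hc,
      mul_comm (sElt C) (MonoidAlgebra.of ℤ G k),
      restrictSupport_of_mul K hk, restrictSupport_sElt hCK.disjoint, mul_one,
      mul_comm]
  | add x y hx hy => simp only [mul_add, map_add, hx, hy]
  | smul r x hx => simp only [mul_smul_comm, map_smul, hx]

lemma restrictSupport_sElt_mul {G : Type} [Group G] [Finite G] {H K : Subgroup G}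
    (hHK : H ≤ K) (x : MonoidAlgebra ℤ G) :
    restrictSupport K (sElt H * x) = sElt H * restrictSupport K x := by
  simp only [sElt, Finset.sum_mul, map_sum]
  exact Finset.sum_congr rfl fun h _ => restrictSupport_of_mul K (hHK h.2) x

/-- The ideal generated by the norm elements of some of the factors of an internal direct product
is the kernel of a `ℤ`-linear endomorphism which is the identity modulo the ideal. -/
lemma exists_projection_mod_span_sElt {G ι : Type} [CommGroup G] [Finite G]
    {H : ι → Subgroup G} (hindep : iSupIndep H) (hgen : ⨆ i, H i = ⊤) (P : Finset ι) :
    ∃ e : MonoidAlgebra ℤ G →ₗ[ℤ] MonoidAlgebra ℤ G,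
      (∀ i ∈ P, ∀ x, e (sElt (H i) * x) = 0) ∧
      (∀ x, x - e x ∈ Ideal.span ((fun i => sElt (H i)) '' (P : Set ι))) ∧
      ∀ i ∉ P, ∀ x, e (sElt (H i) * x) = sElt (H i) * e x := by
  classical
  induction P using Finset.induction_on with
  | empty => exact ⟨LinearMap.id, by simp, by simp, by simp⟩
  | insert a P ha ih =>
    obtain ⟨e, hkill, hmod, hcomm⟩ := ih
    have hcompl : IsCompl (H a) (⨆ k ≠ a, H k) := by
      refine ⟨hindep a, codisjoint_iff.2 (top_unique (hgen ▸ iSup_le fun k => ?_))⟩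
      rcases eq_or_ne k a with rfl | hk
      · exact le_sup_left
      · exact le_sup_of_le_right (le_iSup₂_of_le k hk le_rfl)
    let f := restrictSupport (⨆ k ≠ a, H k)
    refine ⟨e - (LinearMap.mulLeft ℤ (sElt (H a)) ∘ₗ f) ∘ₗ e, ?_, ?_, ?_⟩
    · intro i hi x
      rcases Finset.mem_insert.1 hi with rfl | hi
      · simp [hcomm i ha, f, sElt_mul_restrictSupport hcompl]
      · simp [hkill i hi]
    · intro x
      have h₁ : sElt (H a) * f (e x) ∈
          Ideal.span ((fun i => sElt (H i)) '' ((insert a P : Finset ι) : Set ι)) :=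
        Ideal.mul_mem_right _ _ (Ideal.subset_span ⟨a, by simp, rfl⟩)
      have h₂ := Ideal.span_mono (Set.image_mono (Finset.coe_subset.2 (Finset.subset_insert a P)))
        (hmod x)
      simpa [sub_sub_eq_add_sub, add_sub_right_comm] using add_mem h₂ h₁
    · intro i hi x
      rw [Finset.mem_insert, not_or] at hi
      have hle : H i ≤ ⨆ k ≠ a, H k := le_iSup₂_of_le i hi.1 le_rfl
      simp [hcomm i hi.2, f, restrictSupport_sElt_mul hle, mul_sub, mul_left_comm]

lemma mem_span_sElt_of_zsmul_mem {G ι : Type} [CommGroup G] [Finite G]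
    {H : ι → Subgroup G} (hindep : iSupIndep H) (hgen : ⨆ i, H i = ⊤) (P : Finset ι)
    {k : ℤ} (hk : k ≠ 0) {x : MonoidAlgebra ℤ G}
    (hx : k • x ∈ Ideal.span ((fun i => sElt (H i)) '' (P : Set ι))) :
    x ∈ Ideal.span ((fun i => sElt (H i)) '' (P : Set ι)) := by
  obtain ⟨e, hkill, hmod, -⟩ := exists_projection_mod_span_sElt hindep hgen P
  have hker : ∀ y ∈ Ideal.span ((fun i => sElt (H i)) '' (P : Set ι)), e y = 0 := by
    intro y hy
    induction hy using Submodule.closure_induction with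
    | zero => exact map_zero e
    | add y z _ _ hy hz => rw [map_add, hy, hz, add_zero]
    | smul_mem z y hy =>
      obtain ⟨i, hi, rfl⟩ := hy
      rw [smul_eq_mul, mul_comm]
      exact hkill i hi z
  have h0 : e x = 0 := by
    ext g
    have h := congrArg (fun z => z.coeff g) ((map_smul e k x).symm.trans (hker _ hx))
    rw [MonoidAlgebra.coeff_smul] at h
    simpa [hk] using h
  simpa [h0] using hmod x

/-- The invariants of a finite cyclic group surject onto its second cohomology, and the kernel
consists of the norms. -/
lemma exists_surjective_groupCohomology_two {k D V : Type} [CommRing k] [CommGroup D] [Fintype D]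
    [AddCommGroup V] [Module k V] (ρ : Representation k D V)
    {d : D} (hd : ∀ x, x ∈ Subgroup.zpowers d) :
    ∃ φ : LinearMap.ker (ρ d - LinearMap.id) →+ groupCohomology (Rep.of ρ) 2,
      Function.Surjective φ ∧ ∀ x, φ x = 0 ↔ ∃ y, ρ.norm y = x := by
  refine ⟨(Rep.FiniteCyclicGroup.groupCohomologyπEven (Rep.of ρ) d hd 2 even_two).hom.toAddMonoidHom,
    ?_, fun x => ?_⟩
  · have : CategoryTheory.Epi
        (Rep.FiniteCyclicGroup.groupCohomologyπEven (Rep.of ρ) d hd 2 even_two) := by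
      have : CategoryTheory.Epi (CategoryTheory.ShortComplex.moduleCatCyclesIso
          (Rep.FiniteCyclicGroup.normHomCompSub (Rep.of ρ) d)).inv := inferInstance
      exact @CategoryTheory.epi_comp _ _ _ _ _ _ this _ inferInstance
    exact (ModuleCat.epi_iff_surjective _).1 this
  · exact Rep.FiniteCyclicGroup.groupCohomologyπEven_eq_zero_iff (Rep.of ρ) d hd 2 even_two x

lemma quotRep_apply {G : Type} [CommGroup G] (I : Ideal (MonoidAlgebra ℤ G)) (D : Subgroup G)
    (d : D) (x : MonoidAlgebra ℤ G) :
    quotRep I D d (Ideal.Quotient.mk I x) =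
      Ideal.Quotient.mk I (MonoidAlgebra.of ℤ G d * x) :=
  rfl

lemma norm_quotRep_apply {G : Type} [CommGroup G] [Finite G] (I : Ideal (MonoidAlgebra ℤ G))
    (D : Subgroup G) [Fintype D] (x : MonoidAlgebra ℤ G) :
    (quotRep I D).norm (Ideal.Quotient.mk I x) = Ideal.Quotient.mk I (sElt D * x) := by
  simp only [Representation.norm, LinearMap.sum_apply, quotRep_apply, sElt, Finset.sum_mul,
    map_sum]
  congr!

/-- If `ℤ[G] / I` is torsion-free, then the torsion of the quotient of `ℤ[G]` by `I` and the norm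
element of a cyclic subgroup is the second cohomology of the subgroup with values in `ℤ[G] / I`. -/
lemma nonempty_torsion_equiv_groupCohomology_two {G : Type} [CommGroup G] [Finite G] (j : G)
    (I : Ideal (MonoidAlgebra ℤ G)) (hI : ∀ (k : ℤ) (x), k ≠ 0 → k • x ∈ I → x ∈ I) :
    Nonempty (Submodule.torsion ℤ
        (MonoidAlgebra ℤ G ⧸ (I + Ideal.span {sElt (Subgroup.zpowers j)})) ≃+
      groupCohomology (Rep.of (quotRep I (Subgroup.zpowers j))) 2) := by
  set D := Subgroup.zpowers j
  let _ : Fintype D := Fintype.ofFinite _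
  set Θ := I + Ideal.span {sElt D}
  let d : D := ⟨j, Subgroup.mem_zpowers j⟩
  have hd : ∀ x, x ∈ Subgroup.zpowers d := by
    rintro ⟨_, n, rfl⟩
    exact ⟨n, Subtype.ext (by simp [d])⟩
  obtain ⟨φ, hφ, hφ0⟩ := exists_surjective_groupCohomology_two (quotRep I D) hd
  have hIΘ : I ≤ Θ := le_sup_left
  let q : (MonoidAlgebra ℤ G ⧸ I) →+ (MonoidAlgebra ℤ G ⧸ Θ) :=
    (Ideal.Quotient.factor hIΘ).toAddMonoidHom
  have hq (x) : q (Ideal.Quotient.mk I x) = Ideal.Quotient.mk Θ x := rfl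
  have hq0 (x) : q x = 0 ↔ ∃ y, (quotRep I D).norm y = x := by
    obtain ⟨x, rfl⟩ := Ideal.Quotient.mk_surjective x
    rw [hq, Ideal.Quotient.eq_zero_iff_mem,]
    refine (Submodule.mem_sup (p := I) (p' := Ideal.span {sElt D})).trans ?_
    constructor
    · rintro ⟨a, ha, _, hb, rfl⟩
      obtain ⟨b, rfl⟩ := Ideal.mem_span_singleton'.1 hb
      refine ⟨Ideal.Quotient.mk I b, ?_⟩
      rw [norm_quotRep_apply, map_add, Ideal.Quotient.eq_zero_iff_mem.2 ha, zero_add, mul_comm]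
    · rintro ⟨y, hy⟩
      obtain ⟨y, rfl⟩ := Ideal.Quotient.mk_surjective y
      rw [norm_quotRep_apply, eq_comm, Ideal.Quotient.eq] at hy
      exact ⟨_, hy, _, Ideal.mul_mem_right _ _ (Ideal.mem_span_singleton_self _),
        sub_add_cancel _ _⟩
  have hmem (x) : x ∈ LinearMap.ker (quotRep I D d - LinearMap.id) ↔
      q x ∈ Submodule.torsion ℤ (MonoidAlgebra ℤ G ⧸ Θ) := by
    rw [LinearMap.mem_ker, LinearMap.sub_apply, LinearMap.id_apply, sub_eq_zero,
      Submodule.mem_torsion_iff]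
    constructor
    · intro hx
      refine ⟨⟨(Fintype.card D : ℤ), by simp⟩, ?_⟩
      have hinv : ∀ g : D, quotRep I D g x = x := fun g =>
        (Representation.mem_invariants_iff_of_forall_mem_zpowers _ d hd x).2 hx g
      have hnorm : (quotRep I D).norm x = (Fintype.card D : ℤ) • x := by
        simp [Representation.norm, hinv]
      exact (map_zsmul q _ x).symm.trans ((hq0 _).2 ⟨x, hnorm⟩)
    · rintro ⟨⟨k, hk⟩, hkx⟩
      obtain ⟨y, hy⟩ := (hq0 (k • x)).1 ((map_zsmul q k x).trans hkx)
      have hkd : k • (quotRep I D d x - x) = 0 := by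
        rw [smul_sub, ← map_zsmul, ← hy, Representation.self_norm_apply, sub_self]
      rw [← sub_eq_zero]
      obtain ⟨z, hz⟩ := Ideal.Quotient.mk_surjective (quotRep I D d x - x)
      rw [← hz] at hkd ⊢
      rw [← map_zsmul, Ideal.Quotient.eq_zero_iff_mem] at hkd
      exact Ideal.Quotient.eq_zero_iff_mem.2 (hI k z (nonZeroDivisors.ne_zero hk) hkd)
  let ψ : LinearMap.ker (quotRep I D d - LinearMap.id) →+
      Submodule.torsion ℤ (MonoidAlgebra ℤ G ⧸ Θ) :=
    { toFun x := ⟨q x.1, (hmem x).1 x.2⟩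
      map_zero' := Subtype.ext (map_zero q)
      map_add' x y := Subtype.ext (map_add q x.1 y.1) }
  have hψ : Function.Surjective ψ := by
    rintro ⟨y, hy⟩
    obtain ⟨x, rfl⟩ := Ideal.Quotient.mk_surjective y
    exact ⟨⟨Ideal.Quotient.mk I x, (hmem _).2 hy⟩, rfl⟩
  have hker : ψ.ker = φ.ker := by
    ext x
    rw [AddMonoidHom.mem_ker, AddMonoidHom.mem_ker, hφ0, ← hq0]
    exact Subtype.ext_iff
  exact ⟨(QuotientAddGroup.quotientKerEquivOfSurjective ψ hψ).symm.trans
    ((QuotientAddGroup.quotientAddEquivOfEq hker).trans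
      (QuotientAddGroup.quotientKerEquivOfSurjective φ hφ))⟩

/-- With `G` the internal direct product of the cyclic groups `⟨τ_1⟩, …, ⟨τ_m⟩` (orders
`g_1, …, g_{m-1}, g_m/ℓ^r`, all `g_i` powers of the prime `ℓ`, `ℓ^r ∣ g_m ≤ g_i`),
`j = τ_1^{g_1/g_m} ⋯ τ_{m-1}^{g_{m-1}/g_m} τ_m`, `P ⊆ {1,…,m-1}` and
`Θ = Λ(P) + s(⟨j⟩)Λ`, the torsion subgroup of `Λ/Θ` is isomorphic to
`H²(⟨j⟩, Λ/Λ(P))`, where `⟨j⟩` acts on `Λ/Λ(P)` by left multiplication. -/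
theorem stmt_2 {G : Type} [CommGroup G] [Fintype G]
    (ℓ m r : ℕ) (hℓ : ℓ.Prime) (hm : 2 ≤ m)
    (τ : Fin m → G) (g : Fin m → ℕ)
    (lst : Fin m) (hlst : (lst : ℕ) = m - 1)
    (hpow : ∀ i, ∃ k, g i = ℓ ^ k)
    (hdvd : ℓ ^ r ∣ g lst)
    (hle : ∀ i, g lst ≤ g i)
    (hord : ∀ i, i ≠ lst → orderOf (τ i) = g i)
    (hordlst : orderOf (τ lst) = g lst / ℓ ^ r)
    (hindep : iSupIndep fun i => Subgroup.zpowers (τ i))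
    (hgen : (⨆ i, Subgroup.zpowers (τ i)) = ⊤)
    (j : G) (hj : j = ∏ i, τ i ^ (g i / g lst))
    (P : Finset (Fin m)) (hP : lst ∉ P)
    (ΛP : Ideal (MonoidAlgebra ℤ G))
    (hΛP : ΛP = Ideal.span ((fun i => sElt (Subgroup.zpowers (τ i))) '' (P : Set (Fin m))))
    (Θ : Ideal (MonoidAlgebra ℤ G))
    (hΘ : Θ = ΛP + Ideal.span {sElt (Subgroup.zpowers j)}) :
    Nonempty ((Submodule.torsion ℤ (MonoidAlgebra ℤ G ⧸ Θ)) ≃+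
      (groupCohomology (Rep.of (quotRep ΛP (Subgroup.zpowers j))) 2)) := by
  subst hΘ hΛP
  exact nonempty_torsion_equiv_groupCohomology_two j _ fun k x hk hx =>
    mem_span_sElt_of_zsmul_mem hindep hgen P hk hx
end

section
/- Let C be a finite group and let M be a ℤ[C]-module whose underlying abelian group is torsion-free. Let N := Σ_{c∈C} c denote the norm element of ℤ[C] and let M^C be the submodule of C-fixed elements, so that N·M ⊆ M^C. Then the torsion subgroup of the quotient M/N·M is exactly the image of M^C, i.e. Tor(M/N·M) = M^C/N·M; moreover this torsion subgroup is annihilated by the order of C. -/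
set_option maxHeartbeats 1000000

/-- Let `C` be a finite group and `M` a `ℤ[C]`-module (i.e. an abelian group with a
distributive `C`-action) which is torsion-free as an abelian group.  Let `N : M →+ M` be
the norm map `x ↦ Σ_{c ∈ C} c • x` and `F = M^C` the subgroup of `C`-fixed points, so
that `N(M) ⊆ M^C`.  Then the torsion subgroup of `M/N(M)` is exactly the image of `M^C`,
and it is annihilated by the order of `C`. -/
theorem stmt_3 {C M : Type} [Group C] [Fintype C] [AddCommGroup M]
    [DistribMulAction C M]
    (htf : ∀ (x : M) (n : ℤ), n ≠ 0 → n • x = 0 → x = 0)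
    (N : M →+ M) (hN : ∀ x, N x = ∑ c : C, c • x)
    (F : AddSubgroup M) (hF : ∀ x, x ∈ F ↔ ∀ c : C, c • x = x)
    (hNF : N.range ≤ F) :
    AddCommGroup.torsion (M ⧸ N.range) = F.map (QuotientAddGroup.mk' N.range) ∧
    ∀ x ∈ AddCommGroup.torsion (M ⧸ N.range), (Fintype.card C) • x = 0 := by
  have card_nsmul : ∀ x ∈ F, Fintype.card C • x = N x := fun x hx => by
    simp [hN, fun c => (hF x).1 hx c]
  have card_nsmul_mk : ∀ x ∈ F, Fintype.card C • QuotientAddGroup.mk' N.range x = 0 := by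
    intro x hx
    rw [← map_nsmul, card_nsmul x hx]
    exact (QuotientAddGroup.eq_zero_iff _).2 ⟨x, rfl⟩
  have torsion_eq : AddCommGroup.torsion (M ⧸ N.range) =
      F.map (QuotientAddGroup.mk' N.range) := by
    refine le_antisymm (fun q hq => ?_) ?_
    · obtain ⟨x, rfl⟩ := QuotientAddGroup.mk'_surjective N.range q
      obtain ⟨n, hn, hnx⟩ := isOfFinAddOrder_iff_nsmul_eq_zero.1 hq
      rw [← map_nsmul] at hnx
      have hmem : n • x ∈ F := hNF ((QuotientAddGroup.eq_zero_iff _).1 hnx)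
      refine ⟨x, (hF x).2 fun c => sub_eq_zero.1 <| htf _ n (by exact_mod_cast hn.ne') ?_, rfl⟩
      rw [natCast_zsmul, nsmul_sub, ← smul_comm c n x, (hF _).1 hmem c, sub_self]
    · rintro _ ⟨x, hx, rfl⟩
      exact isOfFinAddOrder_iff_nsmul_eq_zero.2 ⟨_, Fintype.card_pos, card_nsmul_mk x hx⟩
  refine ⟨torsion_eq, fun q hq => ?_⟩
  rw [torsion_eq] at hq
  obtain ⟨x, hx, rfl⟩ := hq
  exact card_nsmul_mk x hx
end

section
/- Let P be a subset of {1,…,m−1} with P ≠ {1,…,m−1}. Then the quotient Λ/(Λ(P) + s(⟨j⟩)·Λ) is a torsion-free abelian group. -/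
set_option maxHeartbeats 1000000

open MonoidAlgebra in
/-- The `ℤ`-linear projection of `ℤ[G]` onto the span of a subset `C` of `G`. -/
noncomputable def restrictTo {G : Type} (C : Set G) :
    MonoidAlgebra ℤ G →ₗ[ℤ] MonoidAlgebra ℤ G :=
  open Classical in
  (MonoidAlgebra.basis G ℤ).constr ℤ fun g => if g ∈ C then single g 1 else 0

open Classical in
theorem restrictTo_single {G : Type} (C : Set G) (g : G) :
    restrictTo C (MonoidAlgebra.single g 1) = if g ∈ C then MonoidAlgebra.single g 1 else 0 := by
  have h := (MonoidAlgebra.basis G ℤ).constr_basis ℤ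
    (fun g => if g ∈ C then MonoidAlgebra.single g (1 : ℤ) else 0) g
  rwa [MonoidAlgebra.basis_apply] at h

theorem sElt_eq_sum {G : Type} [Group G] [Finite G] (H : Subgroup G) [Fintype H] :
    sElt H = ∑ h : H, MonoidAlgebra.single (h : G) (1 : ℤ) := by
  unfold sElt
  simp only [MonoidAlgebra.of_apply]
  congr!

/-- Every element of `ℤ[G]` is a `ℤ`-combination of group elements. -/
theorem monoidAlgebra_int_induction {G : Type} {p : MonoidAlgebra ℤ G → Prop}
    (x : MonoidAlgebra ℤ G) (zero : p 0) (add : ∀ x y, p x → p y → p (x + y))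
    (smul : ∀ (n : ℤ) x, p x → p (n • x)) (single : ∀ g, p (MonoidAlgebra.single g 1)) : p x := by
  have hx : x ∈ Submodule.span ℤ (Set.range (MonoidAlgebra.basis G ℤ)) := by
    rw [Module.Basis.span_eq]; trivial
  induction hx using Submodule.span_induction with
  | mem x h =>
    obtain ⟨g, rfl⟩ := h
    rw [MonoidAlgebra.basis_apply]
    exact single g
  | zero => exact zero
  | add x y _ _ hx hy => exact add x y hx hy
  | smul n x _ hx => exact smul n x hx

/-- An ideal generated by norm elements of subgroups of `W` is stable under the projection onto a
union of cosets of `W`. -/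
theorem restrictTo_mem_span {G : Type} [CommGroup G] [Finite G] {W : Subgroup G} {C : Set G}
    (hC : ∀ g, ∀ w ∈ W, g * w ∈ C ↔ g ∈ C) {S : Set (Subgroup G)} (hS : ∀ H ∈ S, H ≤ W)
    {x : MonoidAlgebra ℤ G} (hx : x ∈ Ideal.span (sElt '' S)) :
    restrictTo C x ∈ Ideal.span (sElt '' S) := by
  classical
  induction hx using Submodule.closure_induction with
  | zero => simp
  | add x y _ _ hx hy => rw [map_add]; exact add_mem hx hy
  | smul_mem r x h =>
    obtain ⟨H, hH, rfl⟩ := h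
    rw [smul_eq_mul]
    induction r using monoidAlgebra_int_induction with
    | zero => simp
    | add x y hx hy => rw [add_mul, map_add]; exact add_mem hx hy
    | smul n x hx =>
      rw [smul_mul_assoc, map_smul]
      exact zsmul_mem hx n
    | single g =>
      have := Fintype.ofFinite H
      have key : restrictTo C (MonoidAlgebra.single g 1 * sElt H)
          = if g ∈ C then MonoidAlgebra.single g 1 * sElt H else 0 := by
        rw [sElt_eq_sum, Finset.mul_sum, map_sum]
        simp only [MonoidAlgebra.single_mul_single, mul_one, restrictTo_single,
          hC _ _ (hS H hH (SetLike.coe_mem _))]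
        split_ifs <;> simp
      rw [key]
      split_ifs
      · exact Ideal.mul_mem_left _ _ (Ideal.subset_span ⟨H, hH, rfl⟩)
      · exact zero_mem _

/-- If `W ⊓ K = 1`, there is a union `C` of cosets of `W` whose `K`-translates partition `G`. -/
theorem exists_cosetUnion {G : Type} [CommGroup G] {W K : Subgroup G} (hWK : Disjoint W K) :
    ∃ C : Set G, (∀ g, ∀ w ∈ W, g * w ∈ C ↔ g ∈ C) ∧ ∀ g, ∃! k : K, (k : G)⁻¹ * g ∈ C := by
  let f : G → G := fun g => (QuotientGroup.mk (s := W ⊔ K) g).out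
  have hf : ∀ g, ∀ u ∈ W ⊔ K, f (g * u) = f g := fun g u hu => by
    simp only [f, QuotientGroup.mk_mul_of_mem g hu]
  refine ⟨{g | (f g)⁻¹ * g ∈ W}, fun g w hw => ?_, fun g => ?_⟩
  · simp only [Set.mem_ofPred_eq]
    rw [hf g w (Subgroup.mem_sup_left hw), ← mul_assoc, W.mul_mem_cancel_right hw]
  · have hg : (f g)⁻¹ * g ∈ W ⊔ K :=
      QuotientGroup.eq.mp (QuotientGroup.out_eq' (QuotientGroup.mk (s := W ⊔ K) g))
    have hk : ∀ k : K, (k : G)⁻¹ * g ∈ {g | (f g)⁻¹ * g ∈ W} ↔ (f g)⁻¹ * g * (k : G)⁻¹ ∈ W := by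
      intro k
      have hfk := hf g (k : G)⁻¹ (inv_mem (Subgroup.mem_sup_right k.2))
      rw [mul_comm, Set.mem_ofPred_eq, hfk, mul_assoc]
    obtain ⟨w, hw, k, hkK, hwk⟩ := Subgroup.mem_sup.mp hg
    refine ⟨⟨k, hkK⟩, ?_, fun k' hk' => ?_⟩
    · refine (hk ⟨k, hkK⟩).mpr ?_
      rwa [← hwk, mul_inv_cancel_right]
    · replace hk' := (hk k').mp hk'
      rw [ ← hwk, mul_assoc, W.mul_mem_cancel_left hw] at hk'
      have := (Subgroup.disjoint_def.mp hWK) hk' (K.mul_mem hkK (inv_mem k'.2))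
      exact Subtype.ext (mul_inv_eq_one.mp this).symm

/-- If `ℤ[G]` modulo the ideal generated by norm elements of subgroups of `W` is torsion-free and
`K ⊓ W = 1`, it remains so after adding the norm element of `K` to the ideal. -/
theorem torsionFree_span_insert {G : Type} [CommGroup G] [Finite G] {W K : Subgroup G}
    (hWK : Disjoint W K) {S : Set (Subgroup G)} (hS : ∀ H ∈ S, H ≤ W)
    (hpure : ∀ (x : MonoidAlgebra ℤ G) (n : ℤ), n ≠ 0 → n • x ∈ Ideal.span (sElt '' S) →
      x ∈ Ideal.span (sElt '' S))
    (x : MonoidAlgebra ℤ G) (n : ℤ) (hn : n ≠ 0)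
    (hx : n • x ∈ Ideal.span (sElt '' S) ⊔ Ideal.span {sElt K}) :
    x ∈ Ideal.span (sElt '' S) ⊔ Ideal.span {sElt K} := by
  classical
  have := Fintype.ofFinite K
  obtain ⟨C, hCW, hCK⟩ := exists_cosetUnion hWK
  obtain ⟨a, ha, b, hb, hab⟩ := Submodule.mem_sup.mp hx
  obtain ⟨y, rfl⟩ := Ideal.mem_span_singleton'.mp hb
  have hinv : ∀ k : K, MonoidAlgebra.single (k : G)⁻¹ (1 : ℤ) * sElt K = sElt K := fun k => by
    rw [sElt_eq_sum, Finset.mul_sum]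
    refine Fintype.sum_equiv (Equiv.mulLeft k⁻¹) _ _ fun h => ?_
    simp [MonoidAlgebra.single_mul_single]
  have hxk : ∀ k : K, MonoidAlgebra.single (k : G)⁻¹ (1 : ℤ) * x - x ∈ Ideal.span (sElt '' S) := by
    intro k
    refine hpure _ n hn ?_
    have : n • (MonoidAlgebra.single (k : G)⁻¹ (1 : ℤ) * x - x)
        = MonoidAlgebra.single (k : G)⁻¹ (1 : ℤ) * a - a := by
      rw [smul_sub, ← mul_smul_comm, ← hab, mul_add, mul_left_comm, hinv]
      ring
    rw [this]
    exact sub_mem (Ideal.mul_mem_left _ _ ha) ha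
  have hdecomp : ∀ z : MonoidAlgebra ℤ G, ∑ k : K, MonoidAlgebra.single (k : G) (1 : ℤ) *
      restrictTo C (MonoidAlgebra.single (k : G)⁻¹ (1 : ℤ) * z) = z := by
    intro z
    induction z using monoidAlgebra_int_induction with
    | zero => simp
    | add x y hx hy => simp only [mul_add, map_add, Finset.sum_add_distrib, hx, hy]
    | smul n x hx => simp only [mul_smul_comm, map_smul, ← Finset.smul_sum, hx]
    | single g =>
      obtain ⟨k, hk, huniq⟩ := hCK g
      rw [Finset.sum_eq_single k]
      · simp [MonoidAlgebra.single_mul_single, restrictTo_single, hk]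
      · intro k' _ hk'
        have : (k' : G)⁻¹ * g ∉ C := fun h => hk' (huniq k' h)
        simp [MonoidAlgebra.single_mul_single, restrictTo_single, this]
      · simp
  have hsplit : x = (∑ k : K, MonoidAlgebra.single (k : G) (1 : ℤ) *
      restrictTo C (MonoidAlgebra.single (k : G)⁻¹ (1 : ℤ) * x - x)) + restrictTo C x * sElt K := by
    conv_lhs => rw [← hdecomp x]
    rw [sElt_eq_sum, mul_comm (restrictTo C x), Finset.sum_mul, ← Finset.sum_add_distrib]
    refine Finset.sum_congr rfl fun k _ => ?_
    rw [map_sub, mul_sub, sub_add_cancel]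
  rw [hsplit]
  exact add_mem
    (Submodule.mem_sup_left <| Submodule.sum_mem _ fun k _ =>
      Ideal.mul_mem_left _ _ (restrictTo_mem_span hCW hS (hxk k)))
    (Submodule.mem_sup_right <| Ideal.mul_mem_left _ _ (Ideal.mem_span_singleton_self _))

/-- For an independent family of subgroups `H i`, the quotient of `ℤ[G]` by the norm elements of
finitely many of them is torsion-free. -/
theorem torsionFree_span_of_iSupIndep {G ι : Type} [CommGroup G] [Finite G] {H : ι → Subgroup G}
    (hH : iSupIndep H) (P : Finset ι) (x : MonoidAlgebra ℤ G) (n : ℤ) (hn : n ≠ 0)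
    (hx : n • x ∈ Ideal.span (sElt '' (H '' (P : Set ι)))) :
    x ∈ Ideal.span (sElt '' (H '' (P : Set ι))) := by
  classical
  induction P using Finset.induction_on generalizing x n with
  | empty =>
    simp only [Finset.coe_empty, Set.image_empty, Ideal.span_empty, Submodule.mem_bot] at hx ⊢
    exact (smul_eq_zero.mp hx).resolve_left hn
  | insert i P hi ih =>
    rw [Finset.coe_insert, Set.image_insert_eq, Set.image_insert_eq, Ideal.span_insert,
      sup_comm] at hx ⊢
    refine torsionFree_span_insert (W := ⨆ k ∈ P, H k) ?_ ?_ ih x n hn hx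
    · refine (hH i).symm.mono_left (iSup₂_mono' fun k hk => ⟨k, ?_, le_rfl⟩)
      rintro rfl
      exact hi hk
    · rintro _ ⟨k, hk, rfl⟩
      exact le_iSup₂_of_le k hk le_rfl

/-- The subgroup generated by `∏ i, τ i ^ (g i / g₀)` meets the subgroup generated by the `τ i`,
`i ∈ P`, trivially, as soon as some `τ q` of order `g q` is left out of `P`. -/
theorem disjoint_iSup_zpowers_prod {G ι : Type} [CommGroup G] [Finite G] [Fintype ι]
    {τ : ι → G} {g : ι → ℕ} {g₀ : ℕ} (hdvd : ∀ i, g₀ ∣ g i)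
    (hord : ∀ i, orderOf (τ i) ∣ g i) (hindep : iSupIndep fun i => Subgroup.zpowers (τ i))
    {P : Finset ι} {q : ι} (hq : q ∉ P) (hordq : orderOf (τ q) = g q) :
    Disjoint (⨆ i ∈ P, Subgroup.zpowers (τ i))
      (Subgroup.zpowers (∏ i, τ i ^ (g i / g₀))) := by
  classical
  rw [Subgroup.disjoint_def]
  intro x hxP hxj
  obtain ⟨k, rfl⟩ := (mem_powers_iff_mem_zpowers.mpr hxj)
  beta_reduce at hxP ⊢
  have hle : (⨆ i ∈ P, Subgroup.zpowers (τ i)) ≤ ⨆ (i) (_ : i ≠ q), Subgroup.zpowers (τ i) :=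
    iSup₂_mono' fun i hi => ⟨i, fun h => hq (h ▸ hi), le_rfl⟩
  have hprod : (∏ i ∈ Finset.univ.erase q, τ i ^ (g i / g₀)) ^ k ∈
      ⨆ (i) (_ : i ≠ q), Subgroup.zpowers (τ i) :=
    pow_mem (Subgroup.prod_mem _ fun i hi =>
      Subgroup.mem_iSup_of_mem i (Subgroup.mem_iSup_of_mem (Finset.ne_of_mem_erase hi)
        (pow_mem (Subgroup.mem_zpowers _) _))) k
  have hmem := hle hxP
  rw [← Finset.mul_prod_erase _ _ (Finset.mem_univ q), mul_pow,
    Subgroup.mul_mem_cancel_right _ hprod, ← pow_mul] at hmem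
  have hone := Subgroup.disjoint_def.mp (hindep q) (pow_mem (Subgroup.mem_zpowers _) _) hmem
  have hgq : 0 < g q := hordq ▸ orderOf_pos (τ q)
  have hk : g₀ ∣ k := by
    have h := orderOf_dvd_of_pow_eq_one hone
    obtain ⟨c, hc⟩ := hdvd q
    have h₀ : 0 < g₀ := Nat.pos_of_dvd_of_pos (hdvd q) hgq
    have hc₀ : 0 < c := Nat.pos_of_mul_pos_left (hc ▸ hgq)
    rw [hordq, hc, Nat.mul_div_cancel_left _ h₀, mul_comm] at h
    exact Nat.dvd_of_mul_dvd_mul_left hc₀ h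
  obtain ⟨c, rfl⟩ := hk
  rw [pow_mul, ← Finset.prod_pow]
  simp only [← pow_mul, Nat.div_mul_cancel (hdvd _), orderOf_dvd_iff_pow_eq_one.mp (hord _),
    Finset.prod_const_one, one_pow]

/-- With `G` the internal direct product of the cyclic groups `⟨τ_1⟩, …, ⟨τ_m⟩` (orders
`g_1, …, g_{m-1}, g_m/ℓ^r`, all `g_i` powers of the prime `ℓ`, `ℓ^r ∣ g_m ≤ g_i`),
`j = τ_1^{g_1/g_m} ⋯ τ_{m-1}^{g_{m-1}/g_m} τ_m`, and `P ⊆ {1,…,m-1}` with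
`P ≠ {1,…,m-1}`, the quotient `Λ/(Λ(P) + s(⟨j⟩)Λ)` is a torsion-free abelian group. -/
theorem stmt_4 {G : Type} [CommGroup G] [Fintype G]
    (ℓ m r : ℕ) (hℓ : ℓ.Prime) (hm : 2 ≤ m)
    (τ : Fin m → G) (g : Fin m → ℕ)
    (lst : Fin m) (hlst : (lst : ℕ) = m - 1)
    (hpow : ∀ i, ∃ k, g i = ℓ ^ k)
    (hdvd : ℓ ^ r ∣ g lst)
    (hle : ∀ i, g lst ≤ g i)
    (hord : ∀ i, i ≠ lst → orderOf (τ i) = g i)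
    (hordlst : orderOf (τ lst) = g lst / ℓ ^ r)
    (hindep : iSupIndep fun i => Subgroup.zpowers (τ i))
    (hgen : (⨆ i, Subgroup.zpowers (τ i)) = ⊤)
    (j : G) (hj : j = ∏ i, τ i ^ (g i / g lst))
    (P : Finset (Fin m)) (hP : lst ∉ P) (hPne : P ≠ Finset.univ.erase lst)
    (Θ : Ideal (MonoidAlgebra ℤ G))
    (hΘ : Θ = Ideal.span ((fun i => sElt (Subgroup.zpowers (τ i))) '' (P : Set (Fin m)))
            + Ideal.span {sElt (Subgroup.zpowers j)}) :
    ∀ (x : MonoidAlgebra ℤ G ⧸ Θ) (n : ℤ), n ≠ 0 → n • x = 0 → x = 0 := by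
  classical
  subst hj
  have hgdvd : ∀ i, g lst ∣ g i := fun i => by
    obtain ⟨a, ha⟩ := hpow lst
    obtain ⟨b, hb⟩ := hpow i
    have := hle i
    rw [ha, hb] at this ⊢
    exact pow_dvd_pow _ ((Nat.pow_le_pow_iff_right hℓ.one_lt).mp this)
  have horddvd : ∀ i, orderOf (τ i) ∣ g i := fun i => by
    by_cases hi : i = lst
    · rw [hi, hordlst]
      exact Nat.div_dvd_of_dvd hdvd
    · rw [hord i hi]
  obtain ⟨q, hqlst, hqP⟩ : ∃ q, q ≠ lst ∧ q ∉ P := by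
    by_contra! h
    refine hPne (Finset.ext fun i => ?_)
    rw [Finset.mem_erase]
    exact ⟨fun hi => ⟨fun hil => hP (hil ▸ hi), Finset.mem_univ i⟩, fun hi => h i hi.1⟩
  have hdisj := disjoint_iSup_zpowers_prod hgdvd horddvd hindep hqP (hord q hqlst)
  intro x n hn hx
  obtain ⟨y, rfl⟩ := Ideal.Quotient.mk_surjective x
  rw [← map_zsmul, Ideal.Quotient.eq_zero_iff_mem] at hx
  rw [Ideal.Quotient.eq_zero_iff_mem]
  rw [hΘ, Submodule.add_eq_sup,
    ← Set.image_image sElt (fun i => Subgroup.zpowers (τ i))] at hx ⊢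
  refine torsionFree_span_insert hdisj ?_
    (fun x n hn hx => torsionFree_span_of_iSupIndep hindep P x n hn hx) y n hn hx
  rintro _ ⟨k, hk, rfl⟩
  exact le_iSup₂_of_le (f := fun i (_ : i ∈ P) => Subgroup.zpowers (τ i)) k hk le_rfl
end

section
/- Let C be a finite cyclic group and K ≤ C a subgroup of order d. Let M := ℤ[C/K] be the free abelian group on the set of cosets C/K, with C acting by translation of cosets. Then for every k ≥ 1, the group cohomology H^k(C, M) is trivial if k is odd, and is cyclic of order d if k is even. -/
open CategoryTheory Rep.FiniteCyclicGroup
open scoped MonoidAlgebra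

namespace QuotientGroup

/-- Summing a function on `G ⧸ K` over all translates of a coset counts each value `#K` times. -/
lemma sum_inv_smul_eq_card_mul_sum {R G : Type*} [CommSemiring R] [Group G] [Fintype G]
    (K : Subgroup G) [Fintype (G ⧸ K)] (f : G ⧸ K → R) (y : G ⧸ K) :
    ∑ g : G, f (g⁻¹ • y) = Nat.card K * ∑ z, f z := by
  classical
  obtain ⟨a, rfl⟩ := QuotientGroup.mk_surjective y
  have := Fintype.ofFinite K
  have h₁ : ∑ g : G, f (g⁻¹ • (a : G ⧸ K)) = ∑ g : G, f (g : G ⧸ K) :=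
    Fintype.sum_equiv ((Equiv.inv G).trans (Equiv.mulRight a)) _ _ fun g => rfl
  have h₂ : ∑ g : G, f (g : G ⧸ K) = ∑ p : (G ⧸ K) × K, f p.1 :=
    Fintype.sum_equiv Subgroup.groupEquivQuotientProdSubgroup _ _ fun g => rfl
  rw [h₁, h₂, Fintype.sum_prod_type_right]
  simp

end QuotientGroup

namespace Representation

variable {k G X : Type*} [CommRing k] [Group G] [MulAction G X]

lemma coeff_norm_ofMulAction_quotient [Fintype G] (K : Subgroup G) [Fintype (G ⧸ K)]
    (x : k[G ⧸ K]) (y : G ⧸ K) :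
    ((ofMulAction k G (G ⧸ K)).norm x).coeff y = Nat.card K * ∑ z, x.coeff z := by
  rw [← QuotientGroup.sum_inv_smul_eq_card_mul_sum K (fun z => x.coeff z) y]
  simp [norm, MonoidAlgebra.coeff_sum]

/-- On a transitive permutation module, elements with zero coefficient sum lie in the
augmentation submodule. -/
lemma mem_coinvariantsKer_ofMulAction [Fintype X] [MulAction.IsPretransitive G X] (x : k[X])
    (hx : ∑ y, x.coeff y = 0) : x ∈ Coinvariants.ker (ofMulAction k G X) := by
  classical
  rcases isEmpty_or_nonempty X with h | ⟨⟨x₀⟩⟩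
  · have : x = 0 := by ext y; exact h.elim y
    exact this ▸ zero_mem _
  have key : x = ∑ y, (.single y (x.coeff y) - .single x₀ (x.coeff y) : k[X]) := by
    ext z
    by_cases hz : x₀ = z <;>
      simp [MonoidAlgebra.coeff_sum, MonoidAlgebra.coeff_single, hx, hz]
  rw [key]
  refine Submodule.sum_mem _ fun y _ => ?_
  obtain ⟨g, rfl⟩ := MulAction.exists_smul_eq G x₀ y
  exact Coinvariants.mem_ker_of_eq g (.single x₀ (x.coeff (g • x₀))) _ (by simp)

lemma coeff_eq_of_mem_invariants_ofMulAction [MulAction.IsPretransitive G X] {x : k[X]}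
    (hx : x ∈ (ofMulAction k G X).invariants) (y z : X) : x.coeff y = x.coeff z := by
  obtain ⟨g, rfl⟩ := MulAction.exists_smul_eq G y z
  conv_rhs => rw [← hx g]
  simp

end Representation

namespace Rep.FiniteCyclicGroup

lemma groupCohomologyπOdd_surjective {k G : Type} [CommRing k] [CommGroup G] [Fintype G]
    (A : Rep.{0} k G) (g : G) (hg : ∀ x, x ∈ Subgroup.zpowers g) (i : ℕ) (hi : Odd i) :
    Function.Surjective (groupCohomologyπOdd A g hg i hi) :=
  (ModuleCat.epi_iff_surjective _).1 <|
    epi_comp' (inferInstanceAs (Epi (subCompNormHom A g).moduleCatCyclesIso.inv))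
      (epi_comp' inferInstance inferInstance)

lemma groupCohomologyπEven_surjective {k G : Type} [CommRing k] [CommGroup G] [Fintype G]
    (A : Rep.{0} k G) (g : G) (hg : ∀ x, x ∈ Subgroup.zpowers g) (i : ℕ) [NeZero i]
    (hi : Even i) : Function.Surjective (groupCohomologyπEven A g hg i hi) :=
  (ModuleCat.epi_iff_surjective _).1 <|
    epi_comp' (inferInstanceAs (Epi (normHomCompSub A g).moduleCatCyclesIso.inv))
      (epi_comp' inferInstance inferInstance)

theorem subsingleton_groupCohomology_quotient_of_odd {C : Type} [CommGroup C] [Fintype C]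
    (K : Subgroup C) {g : C} (hg : ∀ x, x ∈ Subgroup.zpowers g) {i : ℕ} (hi : Odd i) :
    Subsingleton (groupCohomology (Rep.ofMulAction ℤ C (C ⧸ K)) i) := by
  classical
  refine subsingleton_of_forall_eq 0 fun c => ?_
  obtain ⟨x, rfl⟩ := groupCohomologyπOdd_surjective _ g hg i hi c
  rw [groupCohomologyπOdd_eq_zero_iff]
  have hx : (Representation.ofMulAction ℤ C (C ⧸ K)).norm x.1 = 0 := x.2
  have hsum : ∑ z, MonoidAlgebra.coeff x.1 z = 0 := by
    have h := Representation.coeff_norm_ofMulAction_quotient K x.1 ((1 : C) : C ⧸ K)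
    rw [hx] at h
    simpa [Nat.card_pos.ne'] using h.symm
  have := Representation.mem_coinvariantsKer_ofMulAction (G := C) x.1 hsum
  rw [Representation.FiniteCyclicGroup.coinvariantsKer_eq_range _ g hg] at this
  exact this

theorem nonempty_groupCohomology_quotient_addEquiv_zmod {C : Type} [CommGroup C] [Fintype C]
    (K : Subgroup C) {g : C} (hg : ∀ x, x ∈ Subgroup.zpowers g) {i : ℕ} [NeZero i] (hi : Even i) :
    Nonempty (groupCohomology (Rep.ofMulAction ℤ C (C ⧸ K)) i ≃+ ZMod (Nat.card K)) := by
  classical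
  let A := Rep.ofMulAction ℤ C (C ⧸ K)
  let Z := LinearMap.ker (applyAsHom A g - 𝟙 A).hom.toLinearMap
  have hinv (x : ℤ[C ⧸ K]) : x ∈ Z ↔ x ∈ (Representation.ofMulAction ℤ C (C ⧸ K)).invariants := by
    rw [Representation.mem_invariants_iff_of_forall_mem_zpowers _ g hg]
    exact sub_eq_zero (a := Representation.ofMulAction ℤ C (C ⧸ K) g x) (b := x)
  let p : Z →+ groupCohomology A i := (groupCohomologyπEven A g hg i hi).hom.toAddMonoidHom
  have hp : Function.Surjective p := groupCohomologyπEven_surjective A g hg i hi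
  let q : Z →+ ZMod (Nat.card K) :=
    { toFun x := ((MonoidAlgebra.coeff x.1 ((1 : C) : C ⧸ K) : ℤ) : ZMod (Nat.card K))
      map_zero' := by simp
      map_add' x y := by
        rw [← Int.cast_add]
        rfl }
  have hq : Function.Surjective q := fun c => by
    obtain ⟨n, rfl⟩ := ZMod.intCast_surjective c
    obtain ⟨e, he⟩ : ∃ e : ℤ[C ⧸ K], ∀ z, e.coeff z = n :=
      ⟨(MonoidAlgebra.coeffLinearEquiv ℤ).symm (Finsupp.equivFunOnFinite.symm fun _ => n),
        fun z => rfl⟩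
    exact ⟨⟨e, (hinv _).2 fun h => by ext z; simp [he]⟩, congrArg Int.cast (he _)⟩
  have hker : p.ker = q.ker := by
    ext x
    have h₁ : x ∈ p.ker ↔ x.1 ∈ LinearMap.range A.norm.hom.toLinearMap :=
      groupCohomologyπEven_eq_zero_iff A g hg i hi x
    have h₂ : x ∈ q.ker ↔ (Nat.card K : ℤ) ∣ MonoidAlgebra.coeff x.1 ((1 : C) : C ⧸ K) :=
      ZMod.intCast_zmod_eq_zero_iff_dvd _ _
    rw [h₁, h₂]
    constructor
    · rintro ⟨y, hy⟩
      have hy' : (Representation.ofMulAction ℤ C (C ⧸ K)).norm y = x.1 := hy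
      rw [← hy', Representation.coeff_norm_ofMulAction_quotient]
      exact Dvd.intro _ rfl
    · rintro ⟨m, hm⟩
      refine ⟨(.single ((1 : C) : C ⧸ K) m : ℤ[C ⧸ K]), ?_⟩
      change (Representation.ofMulAction ℤ C (C ⧸ K)).norm _ = _
      ext z
      rw [Representation.coeff_norm_ofMulAction_quotient,
        Representation.coeff_eq_of_mem_invariants_ofMulAction ((hinv _).1 x.2) z ((1 : C) : C ⧸ K),
        hm]
      simp [MonoidAlgebra.coeff_single, Finsupp.single_apply]
  exact ⟨(QuotientAddGroup.quotientKerEquivOfSurjective p hp).symm.trans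
    ((QuotientAddGroup.quotientAddEquivOfEq hker).trans
      (QuotientAddGroup.quotientKerEquivOfSurjective q hq))⟩

end Rep.FiniteCyclicGroup

set_option maxHeartbeats 1000000

/-- Let `C` be a finite cyclic group and `K ≤ C` a subgroup of order `d`.  Let
`M = ℤ[C/K]` be the permutation module on the coset space `C/K` (with `C` acting by
translation of cosets).  Then for every `k ≥ 1`, `H^k(C, M) = 0` if `k` is odd, and
`H^k(C, M)` is cyclic of order `d` if `k` is even. -/
theorem stmt_6 {C : Type} [Group C] [Fintype C] [IsCyclic C]
    (K : Subgroup C) (d : ℕ) (hd : Nat.card K = d) (k : ℕ) (hk : 1 ≤ k) :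
    (Odd k → Subsingleton (groupCohomology (Rep.ofMulAction ℤ C (C ⧸ K)) k)) ∧
    (Even k → Nonempty ((groupCohomology (Rep.ofMulAction ℤ C (C ⧸ K)) k) ≃+ ZMod d)) := by
  obtain ⟨_, rfl⟩ : ∃ c : CommGroup C, c.toGroup = ‹Group C› := ⟨IsCyclic.commGroup, rfl⟩
  obtain ⟨g, hg⟩ := IsCyclic.exists_generator (α := C)
  subst hd
  have : NeZero k := ⟨by lia⟩
  exact ⟨subsingleton_groupCohomology_quotient_of_odd K hg,
    nonempty_groupCohomology_quotient_addEquiv_zmod K hg⟩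
end

section
/- Let Θ denote the ideal of Λ generated by the elements s(⟨τ_1⟩), …, s(⟨τ_{m−1}⟩) together with s(⟨j⟩). Then the torsion subgroup of the abelian group Λ/Θ is trivial if m is even, and is cyclic of order ℓ^r if m is odd. -/
set_option maxHeartbeats 1000000

/-- The additive group `{a ∈ K | α a = 0} / β K` is isomorphic to `ZMod q`,
witnessed by a function on the ambient ring. -/
def HasTate {R : Type*} [CommRing R] (α β : R) (K : Ideal R) (q : ℕ) : Prop :=
  ∃ φ : R → ZMod q,
    (∀ a ∈ K, α * a = 0 → ∀ b ∈ K, α * b = 0 → φ (a + b) = φ a + φ b) ∧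
    (∀ c, ∃ a ∈ K, α * a = 0 ∧ φ a = c) ∧
    ∀ a ∈ K, α * a = 0 → (φ a = 0 ↔ ∃ k ∈ K, β * k = a)

theorem HasTate.shift {R : Type*} [CommRing R] {α β s : R} {Q L K : Ideal R} {q : ℕ}
    (E : R →+ R) (hαβ : α * β = 0) (hEQ : ∀ f ∈ Q, E f ∈ Q)
    (hα : ∀ f ∈ Q, α * f = 0 → β * E f = f)
    (hβ : ∀ f ∈ Q, β * f = 0 → ∃ f' ∈ Q, α * f' = f)
    (hsQ : ∀ f ∈ Q, s * f ∈ L) (hsL : ∀ l ∈ L, ∃ f ∈ Q, s * f = l)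
    (hK : ∀ f, f ∈ K ↔ f ∈ Q ∧ s * f = 0) (h : HasTate β α L q) : HasTate α β K q := by
  obtain ⟨ψ, hadd, hsurj, hker⟩ := h
  have hmem : ∀ a ∈ K, α * a = 0 → s * E a ∈ L ∧ β * (s * E a) = 0 := by
    intro a ha h0
    obtain ⟨haQ, hsa⟩ := (hK a).1 ha
    refine ⟨hsQ _ (hEQ _ haQ), ?_⟩
    rw [mul_left_comm, hα a haQ h0, hsa]
  refine ⟨fun f => ψ (s * E f), ?_, ?_, ?_⟩
  · intro a ha ha0 b hb hb0
    have h1 := hmem a ha ha0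
    have h2 := hmem b hb hb0
    simp only [map_add, mul_add]
    exact hadd _ h1.1 h1.2 _ h2.1 h2.2
  · intro c
    obtain ⟨l, hl, hl0, rfl⟩ := hsurj c
    obtain ⟨f, hf, rfl⟩ := hsL l hl
    have hfQ : β * f ∈ Q := Q.mul_mem_left _ hf
    have hα0 : α * (β * f) = 0 := by rw [← mul_assoc, hαβ, zero_mul]
    have hfK : β * f ∈ K := (hK _).2 ⟨hfQ, by rw [mul_left_comm, hl0]⟩
    refine ⟨β * f, hfK, hα0, ?_⟩
    obtain ⟨f', hf', hff'⟩ := hβ (E (β * f) - f) (Q.sub_mem (hEQ _ hfQ) hf)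
      (by rw [mul_sub, hα _ hfQ hα0, sub_self])
    have hd : s * E (β * f) = s * f + α * (s * f') := by
      rw [mul_left_comm, hff']; ring
    have hd0 : β * (α * (s * f')) = 0 := by rw [← mul_assoc, mul_comm β, hαβ, zero_mul]
    have hdL : α * (s * f') ∈ L := L.mul_mem_left _ (hsQ _ hf')
    simp only [hd]
    rw [hadd _ hl hl0 _ hdL hd0, (hker _ hdL hd0).2 ⟨_, hsQ _ hf', rfl⟩, add_zero]
  · intro a ha ha0
    obtain ⟨haL, ha0'⟩ := hmem a ha ha0
    obtain ⟨haQ, hsa⟩ := (hK a).1 ha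
    rw [hker _ haL ha0']
    constructor
    · rintro ⟨l, hl, hla⟩
      obtain ⟨f, hf, rfl⟩ := hsL l hl
      refine ⟨E a - α * f, (hK _).2 ⟨Q.sub_mem (hEQ _ haQ) (Q.mul_mem_left _ hf), ?_⟩, ?_⟩
      · rw [mul_sub, ← hla]; ring
      · rw [mul_sub, hα a haQ ha0, ← mul_assoc, mul_comm β, hαβ, zero_mul, sub_zero]
    · rintro ⟨k, hk, rfl⟩
      obtain ⟨hkQ, hsk⟩ := (hK k).1 hk
      obtain ⟨f', hf', hff'⟩ := hβ (E (β * k) - k) (Q.sub_mem (hEQ _ haQ) hkQ)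
        (by rw [mul_sub, hα _ haQ ha0, sub_self])
      refine ⟨s * f', hsQ _ hf', ?_⟩
      rw [mul_left_comm, hff', mul_sub, hsk, sub_zero]

/-- An element `x` with inverse `y` and `x ^ n = 1`, together with an additive map `e` such that
the conjugates of `e` under the powers of `x` sum to the identity. -/
structure CyclicSplitting {R : Type*} [CommRing R] (x y : R) (n : ℕ) (e : R →+ R) : Prop where
  mul_inv : x * y = 1
  pow_eq : x ^ n = 1
  split : ∀ f, ∑ t ∈ Finset.range n, x ^ t * e (y ^ t * f) = f

namespace CyclicSplitting

variable {R : Type*} [CommRing R] {x y : R} {n : ℕ} {e : R →+ R}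

theorem sub_one_mul_sum (h : CyclicSplitting x y n e) :
    (x - 1) * ∑ t ∈ Finset.range n, x ^ t = 0 := by
  rw [mul_geom_sum, h.pow_eq, sub_self]

theorem mul_sum_pow (h : CyclicSplitting x y n e) :
    x * ∑ t ∈ Finset.range n, x ^ t = ∑ t ∈ Finset.range n, x ^ t := by
  have := h.sub_one_mul_sum
  rw [sub_mul, one_mul] at this
  exact sub_eq_zero.1 this

theorem sum_inv_pow (h : CyclicSplitting x y n e) :
    ∑ t ∈ Finset.range n, y ^ t = ∑ t ∈ Finset.range n, x ^ t := by
  rw [← h.mul_sum_pow, ← Finset.sum_range_reflect (fun t => x ^ t), Finset.mul_sum]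
  refine Finset.sum_congr rfl fun t ht => ?_
  rw [Finset.mem_range] at ht
  have h1 : x ^ t * y ^ t = 1 := by rw [← mul_pow, h.mul_inv, one_pow]
  have h2 : x * x ^ (n - 1 - t) * x ^ t = 1 := by
    rw [← pow_succ', ← pow_add, show n - 1 - t + 1 + t = n by omega, h.pow_eq]
  calc y ^ t = (x * x ^ (n - 1 - t) * x ^ t) * y ^ t := by rw [h2, one_mul]
    _ = x * x ^ (n - 1 - t) * (x ^ t * y ^ t) := by ring
    _ = _ := by rw [h1, mul_one]

theorem inv_pow_mul_of_fixed (h : CyclicSplitting x y n e) {f : R} (hf : (x - 1) * f = 0) (t : ℕ) :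
    y ^ t * f = f := by
  have h1 : x * f = f := by rw [sub_mul, one_mul] at hf; exact sub_eq_zero.1 hf
  have hy : y * f = f := by
    calc y * f = y * (x * f) := by rw [h1]
      _ = (x * y) * f := by ring
      _ = f := by rw [h.mul_inv, one_mul]
  induction t with
  | zero => simp
  | succ t ih => rw [pow_succ, mul_assoc, hy, ih]

theorem sum_mul_of_fixed (h : CyclicSplitting x y n e) {f : R} (hf : (x - 1) * f = 0) :
    (∑ t ∈ Finset.range n, x ^ t) * e f = f := by
  conv_rhs => rw [← h.split f]
  rw [Finset.sum_mul]
  exact Finset.sum_congr rfl fun t _ => by rw [h.inv_pow_mul_of_fixed hf]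

/-- The contracting homotopy attached to a splitting. -/
def homotopy (x y : R) (n : ℕ) (e : R →+ R) : R →+ R :=
  ∑ t ∈ Finset.range n, (AddMonoidHom.mulLeft (∑ u ∈ Finset.range t, x ^ u)).comp
    (e.comp (AddMonoidHom.mulLeft (y ^ t)))

theorem homotopy_apply (f : R) :
    homotopy x y n e f =
      ∑ t ∈ Finset.range n, (∑ u ∈ Finset.range t, x ^ u) * e (y ^ t * f) := by
  simp [homotopy]

theorem sub_one_mul_homotopy (h : CyclicSplitting x y n e) {f : R}
    (hf : (∑ t ∈ Finset.range n, x ^ t) * f = 0) : (x - 1) * homotopy x y n e f = f := by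
  rw [homotopy_apply, Finset.mul_sum]
  have : ∀ t ∈ Finset.range n, (x - 1) * ((∑ u ∈ Finset.range t, x ^ u) * e (y ^ t * f)) =
      x ^ t * e (y ^ t * f) - e (y ^ t * f) := by
    intro t _
    rw [← mul_assoc, mul_geom_sum, sub_mul, one_mul]
  rw [Finset.sum_congr rfl this, Finset.sum_sub_distrib, h.split, ← map_sum, ← Finset.sum_mul,
    h.sum_inv_pow, hf, map_zero, sub_zero]

theorem homotopy_mul {c : R} (hc : ∀ f, e (c * f) = c * e f) (f : R) :
    homotopy x y n e (c * f) = c * homotopy x y n e f := by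
  simp only [homotopy_apply, Finset.mul_sum]
  exact Finset.sum_congr rfl fun t _ => by rw [mul_left_comm, hc]; ring

end CyclicSplitting

/-- The ideal of elements annihilated by all members of a set. -/
def annIdeal {R : Type*} [CommRing R] (C : Set R) : Ideal R where
  carrier := {f | ∀ c ∈ C, c * f = 0}
  add_mem' ha hb c hc := by rw [mul_add, ha c hc, hb c hc, add_zero]
  zero_mem' c _ := mul_zero c
  smul_mem' r f hf c hc := by rw [smul_eq_mul, mul_left_comm, hf c hc, mul_zero]

theorem mem_annIdeal {R : Type*} [CommRing R] {C : Set R} {f : R} :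
    f ∈ annIdeal C ↔ ∀ c ∈ C, c * f = 0 := Iff.rfl

theorem annIdeal_map_mem {R : Type*} [CommRing R] {C : Set R} (E : R →+ R)
    (hE : ∀ c ∈ C, ∀ f, E (c * f) = c * E f) {f : R} (hf : f ∈ annIdeal C) :
    E f ∈ annIdeal C := fun c hc => by rw [← hE c hc, hf c hc, map_zero]

theorem HasTate.shift_both {R : Type*} [CommRing R] {J J' s : R} {h q q' : ℕ} {C : Set R}
    {L K : Ideal R} {E : R →+ R} (hJ : CyclicSplitting J J' h E)
    (hE : ∀ c ∈ C, ∀ f, E (c * f) = c * E f)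
    (hsQ : ∀ f ∈ annIdeal C, s * f ∈ L) (hsL : ∀ l ∈ L, ∃ f ∈ annIdeal C, s * f = l)
    (hK : ∀ f, f ∈ K ↔ f ∈ annIdeal C ∧ s * f = 0)
    (h0 : HasTate (J - 1) (∑ t ∈ Finset.range h, J ^ t) L q)
    (h1 : HasTate (∑ t ∈ Finset.range h, J ^ t) (J - 1) L q') :
    HasTate (J - 1) (∑ t ∈ Finset.range h, J ^ t) K q' ∧
    HasTate (∑ t ∈ Finset.range h, J ^ t) (J - 1) K q := by
  have hP : ∀ c ∈ C, ∀ f, CyclicSplitting.homotopy J J' h E (c * f) =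
      c * CyclicSplitting.homotopy J J' h E f :=
    fun c hc f => CyclicSplitting.homotopy_mul (hE c hc) f
  constructor
  · refine h1.shift E hJ.sub_one_mul_sum (fun f hf => annIdeal_map_mem E hE hf)
      (fun f _ hf0 => hJ.sum_mul_of_fixed hf0)
      (fun f hf hf0 => ⟨_, annIdeal_map_mem _ hP hf, hJ.sub_one_mul_homotopy hf0⟩) hsQ hsL hK
  · refine h0.shift (CyclicSplitting.homotopy J J' h E)
      (by rw [mul_comm]; exact hJ.sub_one_mul_sum) (fun f hf => annIdeal_map_mem _ hP hf)
      (fun f _ hf0 => hJ.sub_one_mul_homotopy hf0)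
      (fun f hf hf0 => ⟨_, annIdeal_map_mem _ hE hf, hJ.sum_mul_of_fixed hf0⟩) hsQ hsL hK

/-- The elements killed by the norms of `x i` for `i ∈ A` and fixed by `x i` for `i ∈ B`. -/
def mixedIdeal {R ι : Type*} [CommRing R] (x : ι → R) (n : ι → ℕ) (A B : Finset ι) : Ideal R :=
  annIdeal ({c | ∃ i ∈ A, c = ∑ t ∈ Finset.range (n i), x i ^ t} ∪ {c | ∃ i ∈ B, c = x i - 1})

theorem mem_mixedIdeal {R ι : Type*} [CommRing R] {x : ι → R} {n : ι → ℕ} {A B : Finset ι}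
    {f : R} : f ∈ mixedIdeal x n A B ↔
      (∀ i ∈ A, (∑ t ∈ Finset.range (n i), x i ^ t) * f = 0) ∧ ∀ i ∈ B, (x i - 1) * f = 0 := by
  rw [mixedIdeal, mem_annIdeal]
  constructor
  · intro h
    exact ⟨fun i hi => h _ (Or.inl ⟨i, hi, rfl⟩), fun i hi => h _ (Or.inr ⟨i, hi, rfl⟩)⟩
  · rintro ⟨h1, h2⟩ c (⟨i, hi, rfl⟩ | ⟨i, hi, rfl⟩)
    exacts [h1 i hi, h2 i hi]

theorem AddMonoidHom.map_pow_mul_of_map_mul {R : Type*} [CommRing R] (E : R →+ R) {c : R}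
    (hc : ∀ f, E (c * f) = c * E f) (t : ℕ) (f : R) : E (c ^ t * f) = c ^ t * E f := by
  induction t generalizing f with
  | zero => simp
  | succ t ih => rw [pow_succ, mul_assoc, ih, hc, mul_assoc]

theorem AddMonoidHom.map_geom_sum_mul_of_map_mul {R : Type*} [CommRing R] (E : R →+ R) {c : R}
    (hc : ∀ f, E (c * f) = c * E f) (n : ℕ) (f : R) :
    E ((∑ t ∈ Finset.range n, c ^ t) * f) = (∑ t ∈ Finset.range n, c ^ t) * E f := by
  rw [Finset.sum_mul, map_sum, Finset.sum_mul]
  exact Finset.sum_congr rfl fun t _ => E.map_pow_mul_of_map_mul hc t f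

theorem mixedIdeal_commute {R ι : Type*} [CommRing R] [DecidableEq ι] {x : ι → R} {n : ι → ℕ}
    {A B : Finset ι} (E : R →+ R) (hE : ∀ i ∈ A ∪ B, ∀ f, E (x i * f) = x i * E f) :
    ∀ c ∈ ({c | ∃ i ∈ A, c = ∑ t ∈ Finset.range (n i), x i ^ t} ∪
      {c | ∃ i ∈ B, c = x i - 1} : Set R), ∀ f, E (c * f) = c * E f := by
  rintro c (⟨i, hi, rfl⟩ | ⟨i, hi, rfl⟩) f
  · exact E.map_geom_sum_mul_of_map_mul (hE i (by simp [hi])) _ f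
  · rw [sub_mul, map_sub, hE i (by simp [hi]), sub_mul, one_mul, one_mul]

theorem hasTate_mixedIdeal {R ι : Type*} [CommRing R] [DecidableEq ι] {x y : ι → R} {n : ι → ℕ}
    {e : ι → R →+ R} {U : Finset ι} {J J' : R} {h q : ℕ}
    (hx : ∀ i ∈ U, CyclicSplitting (x i) (y i) (n i) (e i))
    (he : ∀ k ∈ U, ∀ i ∈ U, i ≠ k → ∀ f, e k (x i * f) = x i * e k f)
    (hJ : ∀ k ∈ U, ∃ E, CyclicSplitting J J' h E ∧
      ∀ i ∈ U, i ≠ k → ∀ f, E (x i * f) = x i * E f)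
    (h0 : HasTate (J - 1) (∑ t ∈ Finset.range h, J ^ t) (mixedIdeal x n ∅ U) q)
    (h1 : HasTate (∑ t ∈ Finset.range h, J ^ t) (J - 1) (mixedIdeal x n ∅ U) 1)
    (S : Finset ι) (hS : S ⊆ U) :
    HasTate (J - 1) (∑ t ∈ Finset.range h, J ^ t) (mixedIdeal x n S (U \ S))
      (if Even S.card then q else 1) ∧
    HasTate (∑ t ∈ Finset.range h, J ^ t) (J - 1) (mixedIdeal x n S (U \ S))
      (if Even S.card then 1 else q) := by
  induction S using Finset.induction_on with
  | empty => simpa using ⟨h0, h1⟩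
  | insert k S hkS ih =>
    have hkU : k ∈ U := hS (Finset.mem_insert_self _ _)
    obtain ⟨ih0, ih1⟩ := ih ((Finset.subset_insert _ _).trans hS)
    obtain ⟨E, hE, hEc⟩ := hJ k hkU
    have hsub : ∀ i ∈ S ∪ (U \ insert k S), i ∈ U ∧ i ≠ k := by
      intro i hi
      rcases Finset.mem_union.1 hi with hi | hi
      · exact ⟨hS (Finset.mem_insert_of_mem hi), fun h => hkS (h ▸ hi)⟩
      · simp only [Finset.mem_sdiff, Finset.mem_insert, not_or] at hi
        exact ⟨hi.1, hi.2.1⟩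
    have hUS : ∀ i, i ∈ U \ S ↔ i = k ∨ i ∈ U \ insert k S := by
      intro i
      simp only [Finset.mem_sdiff, Finset.mem_insert]
      by_cases hik : i = k
      · subst hik; simp [hkU, hkS]
      · simp [hik]
    have key := HasTate.shift_both (s := ∑ t ∈ Finset.range (n k), x k ^ t)
      (L := mixedIdeal x n S (U \ S)) (K := mixedIdeal x n (insert k S) (U \ insert k S)) hE
      (mixedIdeal_commute (n := n) (A := S) (B := U \ insert k S) E
        fun i hi => hEc i (hsub i hi).1 (hsub i hi).2) ?_ ?_ ?_ ih0 ih1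
    · rw [Finset.card_insert_of_notMem hkS]
      by_cases hev : Even S.card
      · have : ¬ Even (S.card + 1) := by simpa [Nat.even_add_one] using hev
        simpa [hev, this] using key
      · have : Even (S.card + 1) := by simpa [Nat.even_add_one] using hev
        simpa only [hev, this, if_true, if_false] using key
    · intro f hf
      change f ∈ mixedIdeal x n S (U \ insert k S) at hf
      have hf' := Ideal.mul_mem_left _ (∑ t ∈ Finset.range (n k), x k ^ t) hf
      rw [mem_mixedIdeal] at hf' ⊢
      refine ⟨hf'.1, fun i hi => ?_⟩
      rcases (hUS i).1 hi with rfl | hi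
      · rw [← mul_assoc, (hx i hkU).sub_one_mul_sum, zero_mul]
      · exact hf'.2 i hi
    · intro l hl
      refine ⟨e k l, ?_, ?_⟩
      · apply annIdeal_map_mem (e k)
          (mixedIdeal_commute (n := n) (A := S) (B := U \ insert k S) (e k)
            fun i hi => he k hkU i (hsub i hi).1 (hsub i hi).2)
        change l ∈ mixedIdeal x n S (U \ insert k S)
        rw [mem_mixedIdeal] at hl ⊢
        exact ⟨hl.1, fun i hi => hl.2 i ((hUS i).2 (Or.inr hi))⟩
      · exact (hx k hkU).sum_mul_of_fixed ((mem_mixedIdeal.1 hl).2 k ((hUS k).2 (Or.inl rfl)))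
    · intro f
      change _ ↔ f ∈ mixedIdeal x n S (U \ insert k S) ∧ _
      rw [mem_mixedIdeal, mem_mixedIdeal]
      simp only [Finset.forall_mem_insert]
      tauto

theorem AddMonoidHom.map_prod_sub_one_mul {R ι : Type*} [CommRing R] (E : R →+ R) {x : ι → R}
    {S : Finset ι} (hE : ∀ i ∈ S, ∀ f, E (x i * f) = x i * E f) (g : R) :
    E ((∏ i ∈ S, (x i - 1)) * g) = (∏ i ∈ S, (x i - 1)) * E g := by
  classical
  induction S using Finset.induction_on generalizing g with
  | empty => simp
  | insert a T haT iht =>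
    rw [Finset.prod_insert haT, mul_assoc, sub_mul, one_mul, map_sub,
      hE a (Finset.mem_insert_self _ _), iht fun i hi => hE i (Finset.mem_insert_of_mem hi)]
    ring

theorem mem_mixedIdeal_iff_exists_prod_mul {R ι : Type*} [CommRing R] [DecidableEq ι]
    {x y : ι → R} {n : ι → ℕ} {e : ι → R →+ R} {U : Finset ι}
    (hx : ∀ i ∈ U, CyclicSplitting (x i) (y i) (n i) (e i))
    (he : ∀ k ∈ U, ∀ i ∈ U, i ≠ k → ∀ f, e k (x i * f) = x i * e k f) (f : R) :
    f ∈ mixedIdeal x n U ∅ ↔ ∃ g, (∏ i ∈ U, (x i - 1)) * g = f := by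
  induction U using Finset.induction_on generalizing f with
  | empty => simp [mem_mixedIdeal]
  | insert k S hkS ih =>
    have ih' := ih (fun i hi => hx i (Finset.mem_insert_of_mem hi))
      (fun k hk i hi => he k (Finset.mem_insert_of_mem hk) i (Finset.mem_insert_of_mem hi))
    have hk := hx k (Finset.mem_insert_self _ _)
    have hcomm : ∀ g, e k ((∏ i ∈ S, (x i - 1)) * g) = (∏ i ∈ S, (x i - 1)) * e k g :=
      (e k).map_prod_sub_one_mul fun i hi =>
        he k (Finset.mem_insert_self _ _) i (Finset.mem_insert_of_mem hi) fun h => hkS (h ▸ hi)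
    have hins : f ∈ mixedIdeal x n (insert k S) ∅ ↔
        (∑ t ∈ Finset.range (n k), x k ^ t) * f = 0 ∧ f ∈ mixedIdeal x n S ∅ := by
      simp [mem_mixedIdeal]
    rw [hins, Finset.prod_insert hkS]
    constructor
    · rintro ⟨h1, h2⟩
      obtain ⟨g, rfl⟩ := (ih' f).1 h2
      refine ⟨CyclicSplitting.homotopy (x k) (y k) (n k) (e k) g, ?_⟩
      rw [mul_assoc, ← CyclicSplitting.homotopy_mul hcomm,
        hk.sub_one_mul_homotopy h1]
    · rintro ⟨g, rfl⟩
      refine ⟨?_, (ih' _).2 ⟨(x k - 1) * g, by ring⟩⟩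
      rw [mul_assoc, ← mul_assoc, mul_comm _ (x k - 1), hk.sub_one_mul_sum, zero_mul]

theorem prod_mul_eq_zero_iff_mem_span {R ι : Type*} [CommRing R] [DecidableEq ι]
    {x y : ι → R} {n : ι → ℕ} {e : ι → R →+ R} {U : Finset ι}
    (hx : ∀ i ∈ U, CyclicSplitting (x i) (y i) (n i) (e i))
    (he : ∀ k ∈ U, ∀ i ∈ U, i ≠ k → ∀ f, e k (x i * f) = x i * e k f) (f : R) :
    (∏ i ∈ U, (x i - 1)) * f = 0 ↔
      f ∈ Ideal.span ((fun i => ∑ t ∈ Finset.range (n i), x i ^ t) '' (U : Set ι)) := by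
  constructor
  · induction U using Finset.induction_on generalizing f with
    | empty => simp
    | insert k S hkS ih =>
      intro hf
      have hk := hx k (Finset.mem_insert_self _ _)
      have hcomm := (e k).map_prod_sub_one_mul (x := x) (S := S) fun i hi =>
        he k (Finset.mem_insert_self _ _) i (Finset.mem_insert_of_mem hi) fun h => hkS (h ▸ hi)
      rw [Finset.prod_insert hkS, mul_assoc] at hf
      have h1 := hk.sum_mul_of_fixed hf
      rw [hcomm, mul_left_comm] at h1
      have h2 := ih (fun i hi => hx i (Finset.mem_insert_of_mem hi))
        (fun k hk i hi => he k (Finset.mem_insert_of_mem hk) i (Finset.mem_insert_of_mem hi))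
        (f - (∑ t ∈ Finset.range (n k), x k ^ t) * e k f) (by rw [mul_sub, h1, sub_self])
      rw [← sub_add_cancel f ((∑ t ∈ Finset.range (n k), x k ^ t) * e k f)]
      refine Ideal.add_mem _ (Ideal.span_mono (Set.image_mono ?_) h2)
        (Ideal.mul_mem_right _ _ (Ideal.subset_span ⟨k, by simp, rfl⟩))
      simp
  · intro hf
    induction hf using Submodule.span_induction with
    | mem z hz =>
      obtain ⟨i, hi, rfl⟩ := hz
      rw [← Finset.mul_prod_erase _ _ hi, mul_right_comm, (hx i hi).sub_one_mul_sum, zero_mul]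
    | zero => simp
    | add a b _ _ ha hb => rw [mul_add, ha, hb, add_zero]
    | smul a b _ hb => rw [smul_eq_mul, mul_left_comm, hb, mul_zero]

theorem Finset.sum_range_mul_eq {M : Type*} [AddCommMonoid M] (f : ℕ → M) (d h : ℕ) :
    ∑ u ∈ Finset.range (d * h), f u =
      ∑ t ∈ Finset.range h, ∑ s ∈ Finset.range d, f (d * t + s) := by
  induction h with
  | zero => simp
  | succ h ih => rw [Nat.mul_succ, Finset.sum_range_add, ih, Finset.sum_range_succ]

/-- The partial sum of conjugates of `e` under the powers of `x` below `d`. -/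
def partialConj {R : Type*} [CommRing R] (x y : R) (d : ℕ) (e : R →+ R) : R →+ R :=
  ∑ s ∈ Finset.range d, (AddMonoidHom.mulLeft (x ^ s)).comp
    (e.comp (AddMonoidHom.mulLeft (y ^ s)))

theorem partialConj_apply {R : Type*} [CommRing R] (x y : R) (d : ℕ) (e : R →+ R) (f : R) :
    partialConj x y d e f = ∑ s ∈ Finset.range d, x ^ s * e (y ^ s * f) := by
  simp [partialConj]

theorem partialConj_mul {R : Type*} [CommRing R] (x y : R) (d : ℕ) (e : R →+ R) {c : R}
    (hc : ∀ f, e (c * f) = c * e f) (f : R) :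
    partialConj x y d e (c * f) = c * partialConj x y d e f := by
  simp only [partialConj_apply, Finset.mul_sum]
  exact Finset.sum_congr rfl fun t _ => by rw [mul_left_comm, hc]; ring

theorem CyclicSplitting.pow_mul_of_unit {R : Type*} [CommRing R] {x y w v : R} {d h : ℕ} {e : R →+ R}
    (hx : CyclicSplitting x y (d * h) e) (hwv : w * v = 1) (hw : w ^ h = 1)
    (hew : ∀ f, e (w * f) = w * e f) :
    CyclicSplitting (x ^ d * w) (y ^ d * v) h (partialConj x y d e) where
  mul_inv := by
    rw [mul_mul_mul_comm, hwv, ← mul_pow, hx.mul_inv, one_pow, one_mul]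
  pow_eq := by rw [mul_pow, ← pow_mul, hx.pow_eq, hw, one_mul]
  split f := by
    have hev : ∀ f, e (v * f) = v * e f := fun f => by
      calc e (v * f) = (w * v) * e (v * f) := by rw [hwv, one_mul]
        _ = v * e (w * (v * f)) := by rw [hew]; ring
        _ = v * e f := by rw [← mul_assoc w, hwv, one_mul]
    conv_rhs => rw [← hx.split f, Finset.sum_range_mul_eq]
    refine Finset.sum_congr rfl fun t _ => ?_
    rw [partialConj_apply, Finset.mul_sum]
    refine Finset.sum_congr rfl fun s _ => ?_
    have h1 : y ^ s * ((y ^ d * v) ^ t * f) = v ^ t * (y ^ (d * t + s) * f) := by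
      rw [mul_pow, pow_add, ← pow_mul]; ring
    rw [h1, e.map_pow_mul_of_map_mul hev]
    calc (x ^ d * w) ^ t * (x ^ s * (v ^ t * e (y ^ (d * t + s) * f)))
        = (w * v) ^ t * (x ^ (d * t + s) * e (y ^ (d * t + s) * f)) := by
          rw [mul_pow, mul_pow, pow_add, ← pow_mul]; ring
      _ = _ := by rw [hwv, one_pow, one_mul]

theorem CyclicSplitting.geom_sum_mul_eq {R : Type*} [CommRing R] {z z' J : R} {n q : ℕ}
    {e : R →+ R} (hz : CyclicSplitting z z' n e) {K : Ideal R}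
    (hJ : ∀ f ∈ K, J * f = z * f) {f : R} (hf : f ∈ K) :
    (∑ t ∈ Finset.range (n * q), J ^ t) * f = (q : R) * ((∑ t ∈ Finset.range n, z ^ t) * f) := by
  have hp : ∀ t, J ^ t * f = z ^ t * f := by
    intro t
    induction t with
    | zero => simp
    | succ t ih =>
      rw [pow_succ', mul_assoc, ih, hJ _ (K.mul_mem_left _ hf), pow_succ', mul_assoc]
  rw [Finset.sum_mul, Finset.sum_congr rfl fun t _ => hp t, ← Finset.sum_mul,
    Finset.sum_range_mul_eq]
  have : ∀ t ∈ Finset.range q, ∑ s ∈ Finset.range n, z ^ (n * t + s) =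
      ∑ s ∈ Finset.range n, z ^ s := fun t _ =>
    Finset.sum_congr rfl fun s _ => by rw [pow_add, pow_mul, hz.pow_eq, one_pow, one_mul]
  rw [Finset.sum_congr rfl this]
  simp [mul_assoc]

theorem CyclicSplitting.hasTate_one {R : Type*} [CommRing R] {z z' J : R} {n q : ℕ}
    {e : R →+ R} (hz : CyclicSplitting z z' n e) {C : Set R}
    (hC : ∀ c ∈ C, ∀ f, e (c * f) = c * e f)
    (hJ : ∀ f ∈ annIdeal C, J * f = z * f) (hq : ∀ f : R, (q : R) * f = 0 → f = 0) :
    HasTate (∑ t ∈ Finset.range (n * q), J ^ t) (J - 1) (annIdeal C) 1 := by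
  refine ⟨fun _ => 0, fun _ _ _ _ _ _ => by simp,
    fun c => ⟨0, zero_mem _, mul_zero _, Subsingleton.elim _ _⟩, fun a ha ha0 => ?_⟩
  simp only [true_iff]
  rw [hz.geom_sum_mul_eq hJ ha] at ha0
  have hmem : homotopy z z' n e a ∈ annIdeal C :=
    annIdeal_map_mem _ (fun c hc f => homotopy_mul (hC c hc) f) ha
  refine ⟨_, hmem, ?_⟩
  rw [sub_mul, hJ _ hmem, ← sub_mul, hz.sub_one_mul_homotopy (hq _ ha0)]

theorem CyclicSplitting.hasTate {R : Type*} [CommRing R] {z z' J σ : R} {n q : ℕ}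
    {e : R →+ R} (hz : CyclicSplitting z z' n e) {C : Set R}
    (hC : ∀ c ∈ C, ∀ f, e (c * f) = c * e f)
    (hJ : ∀ f ∈ annIdeal C, J * f = z * f) (ε : R →+ ℤ) (hσ : σ ∈ annIdeal C)
    (hσz : z * σ = σ) (hεσ : ε σ = 1) (hσε : ∀ f ∈ annIdeal C, z * f = f → f = ε f • σ) :
    HasTate (J - 1) (∑ t ∈ Finset.range (n * q), J ^ t) (annIdeal C) q := by
  have hfix : ∀ f ∈ annIdeal C, (J - 1) * f = 0 ↔ z * f = f := fun f hf => by
    rw [sub_mul, hJ f hf, one_mul, sub_eq_zero]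
  refine ⟨fun f => (ε f : ZMod q), fun a _ _ b _ _ => by simp, fun c => ?_, fun a ha ha0 => ?_⟩
  · obtain ⟨c, rfl⟩ := ZMod.intCast_surjective c
    refine ⟨c • σ, zsmul_mem hσ c, ?_, by dsimp only; rw [map_zsmul, hεσ, smul_eq_mul, mul_one]⟩
    rw [mul_smul_comm, (hfix σ hσ).2 hσz, smul_zero]
  · rw [ZMod.intCast_zmod_eq_zero_iff_dvd]
    constructor
    · rintro ⟨c, hc⟩
      have hcσ : c • σ ∈ annIdeal C := zsmul_mem hσ c
      refine ⟨e (c • σ), annIdeal_map_mem e hC hcσ, ?_⟩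
      rw [hz.geom_sum_mul_eq hJ (annIdeal_map_mem e hC hcσ), hz.sum_mul_of_fixed
        (by rw [mul_smul_comm, sub_mul, hσz, one_mul, sub_self, smul_zero]),
        hσε a ha ((hfix a ha).1 ha0), hc]
      simp [mul_assoc]
    · rintro ⟨k, hk, rfl⟩
      rw [hz.geom_sum_mul_eq hJ hk, ← nsmul_eq_mul, map_nsmul]
      exact ⟨_, nsmul_eq_mul _ _⟩

theorem HasTate.nonempty_torsion_addEquiv {R : Type*} [CommRing R]
    (htf : ∀ a : ℤ, a ≠ 0 → ∀ f : R, a • f = 0 → f = 0) {D J : R} {h q : ℕ} (hh : h ≠ 0)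
    (hJ : J ^ h = 1) {K Θ : Ideal R} (hK : ∀ f, f ∈ K ↔ ∃ g, D * g = f)
    (hΘ : ∀ f, f ∈ Θ ↔ ∃ g, D * f = (∑ t ∈ Finset.range h, J ^ t) * (D * g))
    (H : HasTate (J - 1) (∑ t ∈ Finset.range h, J ^ t) K q) :
    Nonempty (Submodule.torsion ℤ (R ⧸ Θ) ≃+ ZMod q) := by
  obtain ⟨φ, hadd, hsurj, hker⟩ := H
  let X : AddSubgroup R := ((AddMonoidHom.mulLeft ((J - 1) * D)).ker)
  have hX : ∀ f, f ∈ X ↔ (J - 1) * (D * f) = 0 := fun f => by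
    simp [X, AddMonoidHom.mem_ker, mul_assoc]
  have hDK : ∀ f, D * f ∈ K := fun f => (hK _).2 ⟨f, rfl⟩
  have htors : ∀ f, Ideal.Quotient.mk Θ f ∈ Submodule.torsion ℤ (R ⧸ Θ) ↔ f ∈ X := by
    intro f
    rw [hX, Submodule.mem_torsion_iff]
    constructor
    · rintro ⟨a, ha⟩
      have ha' : (a : ℤ) • f ∈ Θ := by
        rw [← Ideal.Quotient.eq_zero_iff_mem, map_zsmul]
        exact ha
      obtain ⟨g, hg⟩ := (hΘ _).1 ha'
      refine htf a (nonZeroDivisors.coe_ne_zero a) _ ?_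
      rw [← mul_smul_comm, ← mul_smul_comm, hg, ← mul_assoc, mul_geom_sum, hJ, sub_self, zero_mul]
    · intro hf
      have hf' : J * (D * f) = D * f := by rwa [sub_mul, one_mul, sub_eq_zero] at hf
      have hp : ∀ t, J ^ t * (D * f) = D * f := by
        intro t
        induction t with
        | zero => simp
        | succ t ih => rw [pow_succ, mul_assoc, hf', ih]
      refine ⟨⟨(h : ℤ), mem_nonZeroDivisors_of_ne_zero (by exact_mod_cast hh)⟩, ?_⟩
      change (h : ℤ) • Ideal.Quotient.mk Θ f = 0
      rw [← map_zsmul, Ideal.Quotient.eq_zero_iff_mem, hΘ]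
      refine ⟨f, ?_⟩
      rw [Finset.sum_mul, Finset.sum_congr rfl fun t _ => hp t]
      simp [mul_left_comm]
  let Φ : X →+ ZMod q := AddMonoidHom.mk' (fun f => φ (D * f)) fun a b => by
    simp only [AddSubgroup.coe_add, mul_add]
    exact hadd _ (hDK _) ((hX _).1 a.2) _ (hDK _) ((hX _).1 b.2)
  let Ψ : X →+ Submodule.torsion ℤ (R ⧸ Θ) :=
    AddMonoidHom.mk' (fun f => ⟨Ideal.Quotient.mk Θ f, (htors f).2 f.2⟩) fun a b => by
      ext; simp
  have hΦ : Function.Surjective Φ := by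
    intro c
    obtain ⟨a, ha, ha0, rfl⟩ := hsurj c
    obtain ⟨g, rfl⟩ := (hK a).1 ha
    exact ⟨⟨g, (hX g).2 ha0⟩, rfl⟩
  have hΨ : Function.Surjective Ψ := by
    rintro ⟨a, ha⟩
    obtain ⟨f, rfl⟩ := Ideal.Quotient.mk_surjective a
    exact ⟨⟨f, (htors f).1 ha⟩, rfl⟩
  have hkk : Ψ.ker = Φ.ker := by
    ext f
    rw [AddMonoidHom.mem_ker, AddMonoidHom.mem_ker]
    change (⟨Ideal.Quotient.mk Θ f, _⟩ : Submodule.torsion ℤ (R ⧸ Θ)) = 0 ↔ φ (D * f) = 0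
    rw [hker _ (hDK _) ((hX _).1 f.2), ← Subtype.coe_inj]
    change Ideal.Quotient.mk Θ f = 0 ↔ _
    rw [Ideal.Quotient.eq_zero_iff_mem, hΘ]
    constructor
    · rintro ⟨g, hg⟩
      exact ⟨_, hDK g, hg.symm⟩
    · rintro ⟨k, hk, hkf⟩
      obtain ⟨g, rfl⟩ := (hK k).1 hk
      exact ⟨g, hkf.symm⟩
  exact ⟨(QuotientAddGroup.quotientKerEquivOfSurjective Ψ hΨ).symm.trans
    ((QuotientAddGroup.quotientAddEquivOfEq hkk).trans
      (QuotientAddGroup.quotientKerEquivOfSurjective Φ hΦ))⟩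

section GroupRing

open MonoidAlgebra

variable {G : Type} [CommGroup G]

/-- Restriction of the coefficient function of a group ring element to a subgroup. -/
noncomputable def restrictCoeff (H : Subgroup G) : MonoidAlgebra ℤ G →+ MonoidAlgebra ℤ G :=
  open Classical in
  (coeffAddEquiv.symm.toAddMonoidHom.comp (Finsupp.filterAddHom (· ∈ H))).comp
    coeffAddEquiv.toAddMonoidHom

theorem restrictCoeff_single_of_mem {H : Subgroup G} {x : G} (hx : x ∈ H) (c : ℤ) :
    restrictCoeff H (single x c) = single x c := by
  classical
  change ofCoeff (Finsupp.filter (· ∈ H) (Finsupp.single x c)) = _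
  rw [Finsupp.filter_single_of_pos _ hx]
  rfl

theorem restrictCoeff_single_of_notMem {H : Subgroup G} {x : G} (hx : x ∉ H) (c : ℤ) :
    restrictCoeff H (single x c) = 0 := by
  classical
  change ofCoeff (Finsupp.filter (· ∈ H) (Finsupp.single x c)) = _
  rw [Finsupp.filter_single_of_neg _ hx]
  rfl

theorem restrictCoeff_of_mul {H : Subgroup G} {w : G} (hw : w ∈ H) (f : MonoidAlgebra ℤ G) :
    restrictCoeff H (of ℤ G w * f) = of ℤ G w * restrictCoeff H f := by
  induction f using MonoidAlgebra.induction_linear with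
  | zero => simp
  | add a b ha hb => rw [mul_add, map_add, ha, hb, map_add, mul_add]
  | single x c =>
    rw [of_apply, single_mul_single, one_mul]
    by_cases hx : x ∈ H
    · rw [restrictCoeff_single_of_mem hx, restrictCoeff_single_of_mem (H.mul_mem hw hx),
        single_mul_single, one_mul]
    · rw [restrictCoeff_single_of_notMem hx, mul_zero, restrictCoeff_single_of_notMem]
      rwa [H.mul_mem_cancel_left hw]

theorem cyclicSplitting_restrictCoeff [Finite G] {x : G} {H : Subgroup G}
    (hd : Disjoint (Subgroup.zpowers x) H) (hc : Subgroup.zpowers x ⊔ H = ⊤) :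
    CyclicSplitting (of ℤ G x) (of ℤ G x⁻¹) (orderOf x) (restrictCoeff H) where
  mul_inv := by rw [← map_mul, mul_inv_cancel, map_one]
  pow_eq := by rw [← map_pow, pow_orderOf_eq_one, map_one]
  split f := by
    induction f using MonoidAlgebra.induction_linear with
    | zero => simp
    | add a b ha hb =>
      conv_rhs => rw [← ha, ← hb]
      rw [← Finset.sum_add_distrib]
      exact Finset.sum_congr rfl fun t _ => by rw [mul_add, map_add, mul_add]
    | single u c =>
      obtain ⟨v, hv, w, hw, rfl⟩ := Subgroup.mem_sup.1 (hc ▸ Subgroup.mem_top u)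
      classical
      rw [mem_zpowers_iff_mem_range_orderOf, Finset.mem_image] at hv
      obtain ⟨s, hs, rfl⟩ := hv
      rw [Finset.sum_eq_single s]
      · rw [← map_pow, ← map_pow, of_apply, of_apply, single_mul_single, one_mul, inv_pow,
          inv_mul_cancel_left, restrictCoeff_single_of_mem hw, single_mul_single, one_mul]
      · intro t ht hts
        rw [← map_pow (of ℤ G) x⁻¹, of_apply _ _ (x⁻¹ ^ t), single_mul_single, restrictCoeff_single_of_notMem,
          mul_zero]
        intro hmem
        rw [← mul_assoc, H.mul_mem_cancel_right hw] at hmem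
        have h1 : x⁻¹ ^ t * x ^ s ∈ Subgroup.zpowers x :=
          mul_mem (pow_mem (inv_mem (Subgroup.mem_zpowers x)) _)
            (pow_mem (Subgroup.mem_zpowers x) _)
        have h2 := Subgroup.disjoint_def.1 hd h1 hmem
        rw [inv_pow, inv_mul_eq_one] at h2
        exact hts (pow_injOn_Iio_orderOf (Finset.mem_range.1 ht) (Finset.mem_range.1 hs) h2)
      · exact fun h => absurd hs h

/-- The group elements fixing a given group ring element. -/
noncomputable def groupStabilizer (f : MonoidAlgebra ℤ G) : Subgroup G where
  carrier := {x | of ℤ G x * f = f}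
  mul_mem' {a b} ha hb := by
    change of ℤ G (a * b) * f = f
    rw [map_mul, mul_assoc, show of ℤ G b * f = f from hb, show of ℤ G a * f = f from ha]
  one_mem' := by change of ℤ G 1 * f = f; rw [map_one, one_mul]
  inv_mem' {a} ha := by
    change of ℤ G a⁻¹ * f = f
    conv_lhs => rw [← show of ℤ G a * f = f from ha]
    rw [← mul_assoc, ← map_mul, inv_mul_cancel, map_one, one_mul]

theorem mem_groupStabilizer {f : MonoidAlgebra ℤ G} {x : G} :
    x ∈ groupStabilizer f ↔ of ℤ G x * f = f := Iff.rfl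

theorem eq_coeff_one_smul_sum [Fintype G] {f : MonoidAlgebra ℤ G}
    (hf : groupStabilizer f = ⊤) : f = f.coeff 1 • ∑ x : G, of ℤ G x := by
  classical
  ext u
  have h1 : of ℤ G u * f = f := mem_groupStabilizer.1 (hf ▸ Subgroup.mem_top u)
  have h2 : (of ℤ G u * f).coeff u = f.coeff 1 := by
    rw [of_apply, coeff_single_mul_eq_mul_coeff (m₂ := 1), one_mul]
    intro m' _
    simp
  rw [h1] at h2
  rw [h2, coeff_smul_apply, coeff_sum, Finsupp.finsetSum_apply]
  simp [Finsupp.single_apply]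

theorem sElt_zpowers [Finite G] (x : G) :
    sElt (Subgroup.zpowers x) = ∑ t ∈ Finset.range (orderOf x), of ℤ G x ^ t := by
  unfold sElt
  rw [Finset.sum_range]
  let _ : Fintype (Subgroup.zpowers x) := Fintype.ofFinite _
  symm
  refine Fintype.sum_equiv (finEquivZPowers (isOfFinOrder_of_finite x)) _ _ fun t => ?_
  rw [finEquivZPowers_apply, map_pow]

end GroupRing

/-- With `G` the internal direct product of the cyclic groups `⟨τ_1⟩, …, ⟨τ_m⟩` (orders
`g_1, …, g_{m-1}, g_m/ℓ^r`, all `g_i` powers of the prime `ℓ`, `ℓ^r ∣ g_m ≤ g_i`) and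
`j = τ_1^{g_1/g_m} ⋯ τ_{m-1}^{g_{m-1}/g_m} τ_m`, let `Θ` be the ideal of `Λ = ℤ[G]`
generated by `s(⟨τ_1⟩), …, s(⟨τ_{m-1}⟩)` and `s(⟨j⟩)`.  Then the torsion subgroup of
`Λ/Θ` is trivial if `m` is even, and cyclic of order `ℓ^r` if `m` is odd. -/
theorem stmt_7 {G : Type} [CommGroup G] [Fintype G]
    (ℓ m r : ℕ) (hℓ : ℓ.Prime) (hm : 2 ≤ m)
    (τ : Fin m → G) (g : Fin m → ℕ)
    (lst : Fin m) (hlst : (lst : ℕ) = m - 1)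
    (hpow : ∀ i, ∃ k, g i = ℓ ^ k)
    (hdvd : ℓ ^ r ∣ g lst)
    (hle : ∀ i, g lst ≤ g i)
    (hord : ∀ i, i ≠ lst → orderOf (τ i) = g i)
    (hordlst : orderOf (τ lst) = g lst / ℓ ^ r)
    (hindep : iSupIndep fun i => Subgroup.zpowers (τ i))
    (hgen : (⨆ i, Subgroup.zpowers (τ i)) = ⊤)
    (j : G) (hj : j = ∏ i, τ i ^ (g i / g lst))
    (Θ : Ideal (MonoidAlgebra ℤ G))
    (hΘ : Θ = Ideal.span (insert (sElt (Subgroup.zpowers j))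
      ((fun i => sElt (Subgroup.zpowers (τ i))) '' {i : Fin m | i ≠ lst}))) :
    (Even m → Subsingleton (Submodule.torsion ℤ (MonoidAlgebra ℤ G ⧸ Θ))) ∧
    (Odd m → Nonempty ((Submodule.torsion ℤ (MonoidAlgebra ℤ G ⧸ Θ)) ≃+ ZMod (ℓ ^ r))) := by
  have hg0 : g lst ≠ 0 := by
    obtain ⟨k, hk⟩ := hpow lst
    rw [hk]; exact pow_ne_zero _ hℓ.ne_zero
  have hq0 : ℓ ^ r ≠ 0 := pow_ne_zero _ hℓ.ne_zero
  have hdv : ∀ i, g lst ∣ g i := fun i => by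
    obtain ⟨k, hk⟩ := hpow lst
    obtain ⟨l, hl⟩ := hpow i
    have := hle i
    rw [hk, hl] at this ⊢
    exact pow_dvd_pow _ ((Nat.pow_le_pow_iff_right hℓ.one_lt).1 this)
  have hdh : ∀ i, i ≠ lst → g i / g lst * g lst = orderOf (τ i) := fun i hi => by
    rw [hord i hi, Nat.div_mul_cancel (hdv i)]
  have hnq : orderOf (τ lst) * ℓ ^ r = g lst := by rw [hordlst, Nat.div_mul_cancel hdvd]
  have hpow1 : ∀ i, (τ i ^ (g i / g lst)) ^ g lst = 1 := fun i => by
    by_cases hi : i = lst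
    · subst hi
      rw [Nat.div_self (Nat.pos_of_ne_zero hg0), pow_one, ← hnq, pow_mul, pow_orderOf_eq_one,
        one_pow]
    · rw [← pow_mul, hdh i hi, pow_orderOf_eq_one]
  set H : Fin m → Subgroup G := fun k => ⨆ i, ⨆ _ : i ≠ k, Subgroup.zpowers (τ i) with hHdef
  have hτH : ∀ i k, i ≠ k → τ i ∈ H k := fun i k hik =>
    (le_iSup₂_of_le (f := fun i (_ : i ≠ k) => Subgroup.zpowers (τ i)) i hik le_rfl)
      (Subgroup.mem_zpowers _)
  have hdisj : ∀ k, Disjoint (Subgroup.zpowers (τ k)) (H k) := fun k => hindep k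
  have hcodisj : ∀ k, Subgroup.zpowers (τ k) ⊔ H k = ⊤ := fun k => by
    rw [eq_top_iff, ← hgen]
    refine iSup_le fun i => ?_
    by_cases hik : i = k
    · subst hik; exact le_sup_left
    · exact le_sup_of_le_right ((Subgroup.zpowers_le).2 (hτH i k hik))
  set w : Fin m → G := fun k => ∏ i ∈ Finset.univ.erase k, τ i ^ (g i / g lst) with hwdef
  have hjw : ∀ k, j = τ k ^ (g k / g lst) * w k := fun k => by
    rw [hj, hwdef, Finset.mul_prod_erase _ (fun i => τ i ^ (g i / g lst)) (Finset.mem_univ k)]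
  have hwH : ∀ k, w k ∈ H k := fun k =>
    Subgroup.prod_mem _ fun i hi => pow_mem (hτH i k (Finset.ne_of_mem_erase hi)) _
  have hwpow : ∀ k, w k ^ g lst = 1 := fun k => by
    rw [hwdef]
    simp only [← Finset.prod_pow]
    exact Finset.prod_eq_one fun i _ => hpow1 i
  obtain ⟨k₀, hk₀⟩ : ∃ k : Fin m, k ≠ lst := by
    refine ⟨⟨0, by omega⟩, fun h => ?_⟩
    rw [← h] at hlst
    simp only at hlst
    omega
  have hjord : orderOf j = g lst := by
    refine Nat.dvd_antisymm (orderOf_dvd_of_pow_eq_one ?_) ?_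
    · rw [hjw k₀, mul_pow, hpow1, hwpow, one_mul]
    · have h1 := pow_orderOf_eq_one j
      rw [hjw k₀, mul_pow, ← hjw k₀] at h1
      have h2 : (τ k₀ ^ (g k₀ / g lst)) ^ orderOf j = 1 := by
        refine Subgroup.disjoint_def.1 (hdisj k₀)
          (pow_mem (pow_mem (Subgroup.mem_zpowers _) _) _) ?_
        rw [eq_inv_of_mul_eq_one_left h1]
        exact inv_mem (pow_mem (hwH k₀) _)
      rw [← pow_mul] at h2
      have h3 := orderOf_dvd_of_pow_eq_one h2
      rw [← hdh k₀ hk₀] at h3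
      refine Nat.dvd_of_mul_dvd_mul_left (Nat.div_pos (hle k₀) (Nat.pos_of_ne_zero hg0)) h3
  have htf : ∀ a : ℤ, a ≠ 0 → ∀ f : MonoidAlgebra ℤ G, a • f = 0 → f = 0 := by
    intro a ha f hf
    ext u
    have h1 : a • f.coeff u = 0 := by
      rw [← MonoidAlgebra.coeff_smul_apply, hf]
      rfl
    exact (smul_eq_zero.1 h1).resolve_left ha
  set x : Fin m → MonoidAlgebra ℤ G := fun i => MonoidAlgebra.of ℤ G (τ i) with hxdef
  set U : Finset (Fin m) := Finset.univ.erase lst with hU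
  have hsplit : ∀ k, CyclicSplitting (x k) (MonoidAlgebra.of ℤ G (τ k)⁻¹) (orderOf (τ k))
      (restrictCoeff (H k)) := fun k => cyclicSplitting_restrictCoeff (hdisj k) (hcodisj k)
  have hcomm : ∀ k i, i ≠ k → ∀ f, restrictCoeff (H k) (x i * f) = x i * restrictCoeff (H k) f :=
    fun k i hik f => restrictCoeff_of_mul (hτH i k hik) f
  have hJ : ∀ k ∈ U, ∃ E, CyclicSplitting (MonoidAlgebra.of ℤ G j)
      (MonoidAlgebra.of ℤ G j⁻¹) (g lst) E ∧
      ∀ i ∈ U, i ≠ k → ∀ f, E (x i * f) = x i * E f := by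
    intro k hk
    have hs := hsplit k
    rw [← hdh k (Finset.ne_of_mem_erase hk)] at hs
    refine ⟨partialConj (x k) (MonoidAlgebra.of ℤ G (τ k)⁻¹) (g k / g lst) (restrictCoeff (H k)),
      ?_, fun i _ hik => partialConj_mul _ _ _ _ (hcomm k i hik)⟩
    have h := hs.pow_mul_of_unit (w := MonoidAlgebra.of ℤ G (w k))
      (v := MonoidAlgebra.of ℤ G (w k)⁻¹) (by rw [← map_mul, mul_inv_cancel, map_one])
      (by rw [← map_pow, hwpow, map_one]) (restrictCoeff_of_mul (hwH k))
    have hjk : MonoidAlgebra.of ℤ G j = x k ^ (g k / g lst) * MonoidAlgebra.of ℤ G (w k) := by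
      rw [hxdef, ← map_pow, ← map_mul, ← hjw]
    have hjk' : MonoidAlgebra.of ℤ G j⁻¹ =
        MonoidAlgebra.of ℤ G (τ k)⁻¹ ^ (g k / g lst) * MonoidAlgebra.of ℤ G (w k)⁻¹ := by
      rw [← map_pow, ← map_mul, inv_pow, ← mul_inv, ← hjw]
    rw [hjk, hjk']
    exact h
  set n : Fin m → ℕ := fun i => orderOf (τ i) with hn
  have hstab : ∀ f ∈ mixedIdeal x n ∅ U, ∀ i, i ≠ lst → τ i ∈ groupStabilizer f := by
    intro f hf i hi
    have h := (mem_mixedIdeal.1 hf).2 i (Finset.mem_erase.2 ⟨hi, Finset.mem_univ _⟩)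
    rwa [sub_mul, one_mul, sub_eq_zero] at h
  have hJz : ∀ f ∈ mixedIdeal x n ∅ U, MonoidAlgebra.of ℤ G j * f = x lst * f := by
    intro f hf
    have h : w lst ∈ groupStabilizer f := Subgroup.prod_mem _ fun i hi =>
      pow_mem (hstab f hf i (Finset.ne_of_mem_erase hi)) _
    rw [hjw lst, Nat.div_self (Nat.pos_of_ne_zero hg0), pow_one, map_mul, mul_assoc,
      mem_groupStabilizer.1 h]
  have hC := mixedIdeal_commute (x := x) (n := n) (A := ∅) (B := U) (restrictCoeff (H lst))
    fun i hi => hcomm lst i (Finset.ne_of_mem_erase (Finset.empty_union U ▸ hi))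
  have hσ : ∀ u, MonoidAlgebra.of ℤ G u * ∑ v : G, MonoidAlgebra.of ℤ G v =
      ∑ v : G, MonoidAlgebra.of ℤ G v := by
    intro u
    rw [Finset.mul_sum]
    exact Fintype.sum_equiv (Equiv.mulLeft u) _ _ fun v => (map_mul _ _ _).symm
  have hσ1 : (∑ v : G, MonoidAlgebra.of ℤ G v).coeff 1 = 1 := by
    classical
    rw [MonoidAlgebra.coeff_sum, Finsupp.finsetSum_apply]
    simp [Finsupp.single_apply]
  have h0 : HasTate (MonoidAlgebra.of ℤ G j - 1)
      (∑ t ∈ Finset.range (g lst), MonoidAlgebra.of ℤ G j ^ t) (mixedIdeal x n ∅ U) (ℓ ^ r) := by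
    rw [← hnq]
    refine (hsplit lst).hasTate hC hJz
      ((Finsupp.applyAddHom (1 : G)).comp
        (MonoidAlgebra.coeffAddEquiv (R := ℤ) (M := G)).toAddMonoidHom)
      (σ := ∑ v : G, MonoidAlgebra.of ℤ G v) ?_ (hσ _) hσ1 ?_
    · refine mem_mixedIdeal.2 ⟨by simp, fun i _ => ?_⟩
      rw [sub_mul, one_mul, hσ, sub_self]
    · intro f hf hf1
      refine eq_coeff_one_smul_sum (eq_top_iff.2 ?_)
      rw [← hgen]
      refine iSup_le fun i => Subgroup.zpowers_le.2 ?_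
      by_cases hi : i = lst
      · subst hi; exact hf1
      · exact hstab f hf i hi
  have h1 : HasTate (∑ t ∈ Finset.range (g lst), MonoidAlgebra.of ℤ G j ^ t)
      (MonoidAlgebra.of ℤ G j - 1) (mixedIdeal x n ∅ U) 1 := by
    rw [← hnq]
    refine (hsplit lst).hasTate_one hC hJz fun f hf => htf (ℓ ^ r : ℕ) (by exact_mod_cast hq0) f ?_
    rw [← hf]
    simp
  have hT := (hasTate_mixedIdeal (fun i _ => hsplit i) (fun k _ i _ => hcomm k i) hJ h0 h1 U
    subset_rfl).1
  rw [Finset.sdiff_self] at hT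
  have hcard : U.card = m - 1 := by
    rw [hU, Finset.card_erase_of_mem (Finset.mem_univ _), Finset.card_univ, Fintype.card_fin]
  have hspan : Θ = Ideal.span (insert (∑ t ∈ Finset.range (g lst), MonoidAlgebra.of ℤ G j ^ t)
      ((fun i => ∑ t ∈ Finset.range (n i), x i ^ t) '' (U : Set (Fin m)))) := by
    rw [hΘ]
    simp only [sElt_zpowers, hjord]
    congr 3
    ext i
    simp [hU]
  have hker := prod_mul_eq_zero_iff_mem_span (U := U) (fun i _ => hsplit i)
    (fun k _ i _ => hcomm k i)
  have hmain := hT.nonempty_torsion_addEquiv htf hg0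
    (by rw [← map_pow, ← hjord, pow_orderOf_eq_one, map_one]) (Θ := Θ)
    (mem_mixedIdeal_iff_exists_prod_mul (fun i _ => hsplit i) (fun k _ i _ => hcomm k i))
    fun f => by
      rw [hspan, Ideal.mem_span_insert]
      constructor
      · rintro ⟨a, z, hz, rfl⟩
        refine ⟨a, ?_⟩
        rw [mul_add, (hker z).2 hz]
        ring
      · rintro ⟨a, ha⟩
        refine ⟨a, _, (hker (f - a * _)).1 ?_, (add_sub_cancel _ _).symm⟩
        rw [mul_sub, ha]
        ring
  rw [hcard] at hmain
  constructor
  · intro hev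
    rw [if_neg (by rw [Nat.even_sub (by omega)]; simp [hev])] at hmain
    obtain ⟨e⟩ := hmain
    exact e.toEquiv.subsingleton
  · intro hodd
    rwa [if_pos (by rw [Nat.even_sub (by omega)]; simpa using hodd)] at hmain
end

section
/- Let n ≥ 1 be an integer. Let F be the free abelian group on the set A_n := {x ∈ ℚ/ℤ : n·x = 0}, with basis elements written [x]. Let R be the subgroup of F generated by all elements of the form [x] − Σ_{y ∈ ℚ/ℤ, p·y = x} [y], where p ranges over the prime divisors of n and x ranges over the elements of ℚ/ℤ with (n/p)·x = 0 (the sum is over the p elements y of ℚ/ℤ with p·y = x; each such y lies in A_n). Then the quotient F/R is a free abelian group of rank φ(n), where φ is Euler's totient function. In particular, the level-n group of the universal ordinary distribution over ℚ is torsion-free. -/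
set_option maxHeartbeats 1000000

/-- The group `ℚ/ℤ`. -/
abbrev QModZ : Type := ℚ ⧸ AddSubgroup.zmultiples (1 : ℚ)

/-- The `n`-torsion subgroup `A_n = {x ∈ ℚ/ℤ : n·x = 0}` of `ℚ/ℤ`, as a type. -/
abbrev nTors (n : ℕ) : Type := {x : QModZ // n • x = 0}

open Finset

/-- `f` satisfies the distribution relations at the primes dividing `n`, twisted by the
endomorphisms `ρ p` of the group of values. -/
def IsTwistedDist (n : ℕ) {G V : Type} [AddCommGroup G] [Fintype G] [DecidableEq G]
    [AddCommGroup V] (ρ : ℕ → V →+ V) (f : G → V) : Prop :=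
  ∀ p : ℕ, p.Prime → p ∣ n → ∀ z : G, ρ p (f (p • z)) = ∑ y with p • y = p • z, f y

/-- Some `φ(n)` elements of `G` freely determine every twisted distribution of level `n`. -/
def HasDistBasis (n : ℕ) (G : Type) [AddCommGroup G] [Fintype G] [DecidableEq G] : Prop :=
  ∃ B : Finset G, #B = n.totient ∧
    ∀ (V : Type) [AddCommGroup V] (ρ : ℕ → V →+ V), (∀ p q v, ρ p (ρ q v) = ρ q (ρ p v)) →
      ∀ c : B → V, ∃! f : G → V, IsTwistedDist n ρ f ∧ ∀ b : B, f b = c b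

theorem HasDistBasis.of_addEquiv {n : ℕ} {G H : Type} [AddCommGroup G] [Fintype G]
    [DecidableEq G] [AddCommGroup H] [Fintype H] [DecidableEq H] (e : G ≃+ H)
    (hG : HasDistBasis n G) : HasDistBasis n H := by
  obtain ⟨B, hB, h⟩ := hG
  refine ⟨B.map e.toEquiv.toEmbedding, by simpa using hB, fun V _ ρ hρ c => ?_⟩
  have key : ∀ (f : H → V), IsTwistedDist n ρ f ↔ IsTwistedDist n ρ (f ∘ e) := by
    intro f
    refine forall₃_congr fun p _ _ => ?_
    rw [e.surjective.forall]
    refine forall_congr' fun z => ?_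
    rw [Finset.sum_equiv (s := {y | p • y = p • z}) (t := {y | p • y = p • e z})
      (f := f ∘ e) (g := f) e.toEquiv]
    · simp
    · intro i
      simp [← map_nsmul]
    · simp
  obtain ⟨f, ⟨hf, hfc⟩, hu⟩ := h V ρ hρ fun b => c ⟨e b, by simp⟩
  refine ⟨f ∘ e.symm, ⟨(key _).2 (by simpa [Function.comp_assoc] using hf), ?_⟩, ?_⟩
  · rintro ⟨b, hb⟩
    obtain ⟨a, ha, rfl⟩ := Finset.mem_map.1 hb
    simpa using hfc ⟨a, ha⟩
  · rintro g ⟨hg, hgc⟩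
    rw [← hu (g ∘ e) ⟨(key g).1 hg, fun b => hgc ⟨e b, by simp⟩⟩]
    ext x
    simp

theorem IsTwistedDist.comp_addMonoidHom {n : ℕ} {G U W : Type} [AddCommGroup G] [Fintype G]
    [DecidableEq G] [AddCommGroup U] [AddCommGroup W] {ρ : ℕ → U →+ U} {σ : ℕ → W →+ W}
    (θ : U →+ W) (hθ : ∀ q : ℕ, q.Prime → q ∣ n → ∀ u, θ (ρ q u) = σ q (θ u)) {f : G → U}
    (hf : IsTwistedDist n ρ f) : IsTwistedDist n σ (fun x => θ (f x)) := by
  intro q hq hqn z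
  rw [← hθ q hq hqn, hf q hq hqn, map_sum]

theorem nsmul_bijective_of_coprime {G : Type} [AddCommGroup G] [Fintype G] {q : ℕ}
    (h : (Nat.card G).Coprime q) : Function.Bijective (fun x : G => q • x) :=
  (nsmulCoprime h).bijective

theorem sum_filter_nsmul_prod {G H V : Type} [AddCommGroup G] [Fintype G] [DecidableEq G]
    [AddCommGroup H] [Fintype H] [DecidableEq H] [AddCommGroup V] (q : ℕ) (f : G × H → V)
    (z : G) (w : H) :
    ∑ y with q • y = q • (z, w), f y =
      ∑ y with q • y = q • z, ∑ v with q • v = q • w, f (y, v) := by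
  rw [← Finset.sum_product']
  refine Finset.sum_congr ?_ fun _ _ => rfl
  ext ⟨y, v⟩
  simp

theorem filter_nsmul_eq_singleton {G : Type} [AddCommGroup G] [Fintype G] [DecidableEq G]
    {q : ℕ} (h : Function.Bijective (fun x : G => q • x)) (z : G) :
    ({y | q • y = q • z} : Finset G) = {z} := by
  ext y
  simpa using h.1.eq_iff (a := y) (b := z)

/-- Precomposing with multiplication by `p` preserves the distribution relations when that
multiplication is bijective. -/
theorem sum_filter_nsmul_comp {G V : Type} [AddCommGroup G] [Fintype G] [DecidableEq G]
    [AddCommGroup V] {p : ℕ} (h : Function.Bijective (fun x : G => p • x)) (q : ℕ) (f : G → V)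
    (z : G) :
    ∑ y with q • y = q • p • z, f y = ∑ y with q • y = q • z, f (p • y) := by
  symm
  refine Finset.sum_equiv (Equiv.ofBijective _ h) ?_ ?_
  · intro y
    simp only [mem_filter_univ, Equiv.ofBijective_apply]
    rw [smul_comm q p y, smul_comm q p z, h.1.eq_iff]
  · simp

theorem existsUnique_fixedPoint_of_iterate_const {X : Type*} [Nonempty X] (Φ : X → X) (N : ℕ)
    (h : ∀ x y, Φ^[N] x = Φ^[N] y) : ∃! x, Φ x = x := by
  obtain ⟨x⟩ := ‹Nonempty X›
  refine ⟨Φ^[N] x, ?_, fun y hy => ?_⟩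
  · change Φ (Φ^[N] x) = _
    rw [← Function.iterate_succ_apply' Φ, Function.iterate_succ_apply]
    exact h _ _
  · rw [← h y x]
    exact (Function.iterate_fixed hy N).symm

/-- A transversal avoiding `0` for the fibres of multiplication by `p` on
`ZMod (p ^ (k + 1))`. -/
theorem exists_fibre_transversal {p k : ℕ} (hp : p.Prime) :
    ∃ C : Finset (ZMod (p ^ (k + 1))), 0 ∉ C ∧ #C = p ^ k ∧
      ∀ z, ∃ y ∈ C, p • y = p • z ∧ ∀ x ∈ C, p • x = p • z → x = y := by
  have : NeZero (p ^ (k + 1)) := ⟨pow_ne_zero _ hp.ne_zero⟩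
  have hpk : 0 < p ^ k := pow_pos hp.pos k
  have key : ∀ i j : ℕ, p • ((i : ZMod (p ^ (k + 1))) + ((p ^ k : ℕ) : ZMod _)) = p • (j : ZMod _) ↔
      i ≡ j [MOD p ^ k] := by
    intro i j
    have h1 : p • ((i : ZMod (p ^ (k + 1))) + ((p ^ k : ℕ) : ZMod _)) = ((p * i : ℕ) : ZMod _) := by
      have h0 : ((p * p ^ k : ℕ) : ZMod (p ^ (k + 1))) = 0 := by
        rw [← pow_succ', ZMod.natCast_self]
      rw [nsmul_eq_mul, mul_add, ← Nat.cast_mul, ← Nat.cast_mul, h0, add_zero]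
    rw [h1, nsmul_eq_mul, ← Nat.cast_mul, ZMod.natCast_eq_natCast_iff, pow_succ']
    exact Nat.ModEq.mul_left_cancel_iff' hp.ne_zero
  have inj : ∀ i j : ℕ, i < p ^ k → j < p ^ k →
      p • ((i : ZMod (p ^ (k + 1))) + ((p ^ k : ℕ) : ZMod _)) =
        p • ((j : ZMod (p ^ (k + 1))) + ((p ^ k : ℕ) : ZMod _)) → i = j := by
    intro i j hi hj h
    rw [← Nat.cast_add j, key] at h
    have h2 : i ≡ j [MOD p ^ k] := h.trans (by simp [Nat.ModEq])
    exact Nat.ModEq.eq_of_lt_of_lt h2 hi hj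
  refine ⟨(range (p ^ k)).image fun i : ℕ => (i : ZMod _) + ((p ^ k : ℕ) : ZMod _), ?_, ?_, ?_⟩
  · intro h
    obtain ⟨i, hi, h⟩ := Finset.mem_image.1 h
    rw [← Nat.cast_add, ZMod.natCast_eq_zero_iff] at h
    have hi := Finset.mem_range.1 hi
    have := Nat.le_of_dvd (by lia) h
    have h2 : 2 * p ^ k ≤ p ^ (k + 1) := by
      rw [pow_succ']
      exact Nat.mul_le_mul_right _ hp.two_le
    lia
  · rw [Finset.card_image_of_injOn, card_range]
    intro i hi j hj h
    exact inj i j (by simpa using hi) (by simpa using hj) (congrArg (p • ·) h)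
  · intro z
    have hz : p • (((z.val % p ^ k : ℕ) : ZMod (p ^ (k + 1))) + ((p ^ k : ℕ) : ZMod _)) = p • z := by
      conv_rhs => rw [← ZMod.natCast_zmod_val z]
      rw [key]
      exact Nat.mod_modEq _ _
    refine ⟨_, Finset.mem_image_of_mem _ (mem_range.2 (Nat.mod_lt z.val hpk)), hz, ?_⟩
    intro x hx hxz
    obtain ⟨i, hi, rfl⟩ := Finset.mem_image.1 hx
    have := inj i (z.val % p ^ k) (mem_range.1 hi) (Nat.mod_lt _ hpk) (hxz.trans hz.symm)
    simp only [this]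

/-- The endomorphism `u ↦ ρ q ∘ u ∘ (q • ·)` of `G → V`. -/
def twistPi (G : Type) {V : Type} [AddCommGroup G] [AddCommGroup V] (ρ : ℕ → V →+ V) (q : ℕ) :
    (G → V) →+ (G → V) where
  toFun u z := ρ q (u (q • z))
  map_zero' := by ext; simp
  map_add' _ _ := by ext; simp

theorem twistPi_apply {G V : Type} [AddCommGroup G] [AddCommGroup V] (ρ : ℕ → V →+ V) (q : ℕ)
    (u : G → V) (z : G) : twistPi G ρ q u z = ρ q (u (q • z)) := rfl

/-- Distributions on a product of groups of coprime orders: the relations at the primes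
dividing the order of the second factor are those of a twisted distribution with values in
functions on the first factor. -/
theorem isTwistedDist_prod_iff {p k m : ℕ} (hp : p.Prime) {G H V : Type}
    [AddCommGroup G] [Fintype G] [DecidableEq G] [AddCommGroup H] [Fintype H] [DecidableEq H]
    [AddCommGroup V] (hpH : Function.Bijective (fun x : H => p • x))
    (hqG : ∀ q : ℕ, q.Prime → q ∣ m → Function.Bijective (fun x : G => q • x)) (ρ : ℕ → V →+ V)
    (f : G × H → V) :
    IsTwistedDist (p ^ (k + 1) * m) ρ f ↔
      IsTwistedDist m (twistPi G ρ) (fun w z => f (z, w)) ∧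
      ∀ z w, ρ p (f (p • z, p • w)) = ∑ y with p • y = p • z, f (y, w) := by
  constructor
  · intro h
    refine ⟨fun q hq hqm w => ?_, fun z w => ?_⟩
    · ext z
      have := h q hq (hqm.mul_left _) (z, w)
      rw [sum_filter_nsmul_prod, filter_nsmul_eq_singleton (hqG q hq hqm),
        sum_singleton] at this
      rw [Finset.sum_apply]
      exact this
    · have := h p hp ((dvd_pow_self p k.succ_ne_zero).mul_right _) (z, w)
      rw [sum_filter_nsmul_prod] at this
      simpa only [filter_nsmul_eq_singleton hpH, sum_singleton, Prod.smul_mk] using this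
  · rintro ⟨h1, h2⟩ q hq hqn ⟨z, w⟩
    rw [sum_filter_nsmul_prod]
    rcases (hq.dvd_mul).1 hqn with hqp | hqm
    · obtain rfl := (Nat.prime_dvd_prime_iff_eq hq hp).1 (hq.dvd_of_dvd_pow hqp)
      simpa only [filter_nsmul_eq_singleton hpH, sum_singleton, Prod.smul_mk] using h2 z w
    · rw [filter_nsmul_eq_singleton (hqG q hq hqm), sum_singleton]
      have := congrFun (h1 q hq hqm w) z
      rw [Finset.sum_apply] at this
      exact this

/-- Both sides of the relations at `p` are themselves twisted distributions. -/
theorem IsTwistedDist.relation_sides {p m : ℕ} {G H V : Type}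
    [AddCommGroup G] [Fintype G] [DecidableEq G] [AddCommGroup H] [Fintype H] [DecidableEq H]
    [AddCommGroup V] (hpH : Function.Bijective (fun x : H => p • x))
    (hqG : ∀ q : ℕ, q.Prime → q ∣ m → Function.Bijective (fun x : G => q • x))
    {ρ : ℕ → V →+ V} (hρ : ∀ p q v, ρ p (ρ q v) = ρ q (ρ p v)) {F : H → G → V}
    (hF : IsTwistedDist m (twistPi G ρ) F) :
    IsTwistedDist m (twistPi G ρ) (fun w z => ρ p (F (p • w) (p • z))) ∧
      IsTwistedDist m (twistPi G ρ) (fun w z => ∑ y with p • y = p • z, F w y) := by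
  constructor
  · intro q hq hqm w
    ext z
    have := congrFun (hF q hq hqm (p • w)) (p • z)
    rw [sum_filter_nsmul_comp hpH, twistPi_apply, Finset.sum_apply] at this
    rw [twistPi_apply, hρ, Finset.sum_apply, ← map_sum, ← this, smul_comm p q w,
      smul_comm p q z]
  · intro q hq hqm w
    ext z
    rw [twistPi_apply, Finset.sum_apply]
    change ρ q (∑ y with p • y = p • q • z, F (q • w) y) = _
    rw [sum_filter_nsmul_comp (hqG q hq hqm), map_sum, Finset.sum_comm]
    refine Finset.sum_congr rfl fun y _ => ?_
    have := congrFun (hF q hq hqm w) y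
    rw [Finset.sum_apply] at this
    exact this

theorem sum_filter_nsmul_of_transversal {G V : Type} [AddCommGroup G] [Fintype G]
    [DecidableEq G] [AddCommGroup V] {p : ℕ} {C : Finset G} {z y : G} (hy : y ∈ C)
    (hyz : p • y = p • z) (hu : ∀ x ∈ C, p • x = p • z → x = y) (u : G → V) :
    ∑ x with p • x = p • z, u x = u y + ∑ x with p • x = p • z ∧ x ∉ C, u x := by
  rw [← Finset.sum_filter_add_sum_filter_not _ (· ∈ C), Finset.filter_filter,
    Finset.filter_filter]
  congr 1
  rw [← Finset.sum_singleton u y]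
  refine Finset.sum_congr ?_ fun _ _ => rfl
  ext x
  simp only [mem_filter_univ, mem_singleton]
  constructor
  · rintro ⟨h1, h2⟩
    exact hu x h2 h1
  · rintro rfl
    exact ⟨hyz, hy⟩

/-- Restriction to the `N`-torsion subgroup, extended by zero, as an endomorphism of `G → V`. -/
def restrictTorsion (G V : Type) [AddCommGroup G] [DecidableEq G] [AddCommGroup V] (N : ℕ) :
    (G → V) →+ (G → V) where
  toFun u z := if N • z = 0 then u z else 0
  map_zero' := by ext; simp
  map_add' _ _ := by ext; simp only [Pi.add_apply]; split_ifs <;> simp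

theorem restrictTorsion_apply {G V : Type} [AddCommGroup G] [DecidableEq G] [AddCommGroup V]
    (N : ℕ) (u : G → V) (z : G) :
    restrictTorsion G V N u z = if N • z = 0 then u z else 0 := rfl

theorem restrictTorsion_twistPi {G V : Type} [AddCommGroup G] [DecidableEq G] [AddCommGroup V]
    (ρ : ℕ → V →+ V) {q : ℕ} (hq : Function.Bijective (fun x : G => q • x)) (N : ℕ)
    (u : G → V) :
    restrictTorsion G V N (twistPi G ρ q u) = twistPi G ρ q (restrictTorsion G V N u) := by
  ext z
  have : N • q • z = 0 ↔ N • z = 0 := by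
    rw [smul_comm]
    exact ⟨fun h => hq.1 (by simpa using h), fun h => by rw [h, smul_zero]⟩
  simp only [restrictTorsion_apply, twistPi_apply, this]
  split_ifs <;> simp

theorem HasDistBasis.prod {p k m : ℕ} (hp : p.Prime) (hpm : ¬ p ∣ m) {G H : Type}
    [AddCommGroup G] [Fintype G] [DecidableEq G] [AddCommGroup H] [Fintype H] [DecidableEq H]
    (hG : Nat.card G = p ^ (k + 1)) (hH : Nat.card H = m) {C : Finset G} (hC0 : 0 ∉ C)
    (hCcard : #C = p ^ k)
    (hC : ∀ z, ∃ y ∈ C, p • y = p • z ∧ ∀ x ∈ C, p • x = p • z → x = y)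
    (h : HasDistBasis m H) : HasDistBasis (p ^ (k + 1) * m) (G × H) := by
  have hpH : Function.Bijective (fun x : H => p • x) :=
    nsmul_bijective_of_coprime (by rw [hH]; exact ((hp.coprime_iff_not_dvd).2 hpm).symm)
  have hqG : ∀ q : ℕ, q.Prime → q ∣ m → Function.Bijective (fun x : G => q • x) := by
    intro q hq hqm
    refine nsmul_bijective_of_coprime ?_
    rw [hG]
    refine Nat.Coprime.pow_left _ ((Nat.coprime_primes hp hq).2 ?_)
    rintro rfl
    exact hpm hqm
  obtain ⟨B, hBcard, hB⟩ := h
  refine ⟨Cᶜ ×ˢ B, ?_, ?_⟩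
  · rw [card_product, card_compl, hCcard, hBcard, ← Nat.card_eq_fintype_card, hG,
      Nat.totient_mul (((hp.coprime_iff_not_dvd).2 hpm).pow_left _),
      Nat.totient_prime_pow_succ hp, pow_succ, Nat.mul_sub_one]
  intro V _ ρ hρ c
  have hρ' : ∀ p q v, twistPi G ρ p (twistPi G ρ q v) = twistPi G ρ q (twistPi G ρ p v) := by
    intro p q v
    ext z
    simp only [twistPi_apply]
    rw [hρ, smul_comm]
  choose distExt hext hextu using hB (G → V) (twistPi G ρ) hρ'
  have hunique : ∀ F F' : H → G → V, IsTwistedDist m (twistPi G ρ) F →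
      IsTwistedDist m (twistPi G ρ) F' → (∀ b : B, F b = F' b) → F = F' := by
    intro F F' hF hF' hFF
    rw [hextu (fun b => F b) F ⟨hF, fun _ => rfl⟩,
      hextu (fun b => F b) F' ⟨hF', fun b => (hFF b).symm⟩]
  have hlocal : ∀ (N : ℕ) (d d' : B → G → V), (∀ b z, N • z = 0 → d b z = d' b z) →
      ∀ w z, N • z = 0 → distExt d w z = distExt d' w z := by
    intro N d d' hd w z hz
    have comm := fun q (hq : q.Prime) (hqm : q ∣ m) (u : G → V) =>
      restrictTorsion_twistPi ρ (hqG q hq hqm) N u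
    have := hunique _ _ ((hext d).1.comp_addMonoidHom (restrictTorsion G V N) comm)
      ((hext d').1.comp_addMonoidHom (restrictTorsion G V N) comm) (by
        intro b
        ext z
        rw [(hext d).2, (hext d').2, restrictTorsion_apply, restrictTorsion_apply]
        split_ifs with hz
        · exact hd b z hz
        · rfl)
    have := congrFun (congrFun this w) z
    simpa only [restrictTorsion_apply, if_pos hz] using this
  let g : G → H → V := fun z w => if h : (z, w) ∈ Cᶜ ×ˢ B then c ⟨(z, w), h⟩ else 0
  have hg : ∀ f : G × H → V, (∀ b : ↥(Cᶜ ×ˢ B), f b = c b) ↔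
      ∀ z, z ∉ C → ∀ b : B, f (z, b) = g z b := by
    intro f
    constructor
    · intro h z hz b
      have hmem : (z, (b : H)) ∈ Cᶜ ×ˢ B := by simp [hz]
      simp only [g, dif_pos hmem]
      exact h ⟨_, hmem⟩
    · rintro h ⟨⟨z, b⟩, hb⟩
      have hb' := hb
      simp only [mem_product, mem_compl] at hb'
      have := h z hb'.1 ⟨b, hb'.2⟩
      simpa only [g, dif_pos hb] using this
  -- The fixed points of `Φ` are the values on `B` of the distributions extending `g`.
  let Φ : (B → G → V) → (B → G → V) := fun d b z =>
    if z ∈ C then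
      ρ p (distExt d (p • (b : H)) (p • z)) - ∑ y with p • y = p • z ∧ y ∉ C, g y b
    else g z b
  have hΦC : ∀ d b z, z ∈ C → Φ d b z =
      ρ p (distExt d (p • (b : H)) (p • z)) - ∑ y with p • y = p • z ∧ y ∉ C, g y b :=
    fun _ _ _ hz => if_pos hz
  have hΦg : ∀ d b z, z ∉ C → Φ d b z = g z b := fun _ _ _ hz => if_neg hz
  have hΦ : ∀ (j : ℕ) (d d' : B → G → V) (b : B) (z : G), p ^ j • z = 0 →
      Φ^[j + 1] d b z = Φ^[j + 1] d' b z := by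
    intro j
    induction j with
    | zero =>
      intro d d' b z hz
      obtain rfl : z = 0 := by simpa using hz
      exact (hΦg _ _ _ hC0).trans (hΦg _ _ _ hC0).symm
    | succ j ih =>
      intro d d' b z hz
      rw [Function.iterate_succ_apply' Φ (j + 1), Function.iterate_succ_apply' Φ (j + 1)]
      by_cases hzC : z ∈ C
      · rw [hΦC _ _ _ hzC, hΦC _ _ _ hzC,
          hlocal (p ^ j) _ _ (ih d d') (p • (b : H)) (p • z)
          (by rwa [smul_smul, ← pow_succ])]
      · rw [hΦg _ _ _ hzC, hΦg _ _ _ hzC]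
  obtain ⟨d, hd, hdu⟩ := existsUnique_fixedPoint_of_iterate_const Φ (k + 1 + 1) (by
    intro d d'
    ext b z
    exact hΦ (k + 1) d d' b z (by rw [← hG]; exact card_nsmul_eq_zero'))
  refine ⟨fun x => distExt d x.2 x.1, ⟨?_, ?_⟩, ?_⟩
  · rw [isTwistedDist_prod_iff hp hpH hqG]
    refine ⟨(hext d).1, ?_⟩
    have hs := (hext d).1.relation_sides hpH hqG hρ
    have := hunique _ _ hs.1 hs.2 (by
      intro b
      ext z
      obtain ⟨y, hy, hyz, hyu⟩ := hC z
      have hdy := congrFun (congrFun hd b) y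
      rw [hΦC _ _ _ hy, hyz] at hdy
      rw [sum_filter_nsmul_of_transversal hy hyz hyu, (hext d).2, ← hdy, sub_add]
      rw [eq_comm, sub_eq_self, sub_eq_zero]
      refine Finset.sum_congr rfl fun x hx => ?_
      have hx := ((mem_filter_univ _).1 hx).2
      rw [← congrFun (congrFun hd b) x, hΦg _ _ _ hx])
    exact fun z w => congrFun (congrFun this w) z
  · refine (hg fun x => distExt d x.2 x.1).2 fun z hz b => ?_
    simp only
    rw [(hext d).2, ← congrFun (congrFun hd b) z, hΦg _ _ _ hz]
  · rintro f ⟨hf, hfc⟩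
    rw [isTwistedDist_prod_iff hp hpH hqG] at hf
    rw [hg] at hfc
    have hF : (fun w z => f (z, w)) = distExt (fun b z => f (z, b)) :=
      hextu _ _ ⟨hf.1, fun _ => rfl⟩
    have : (fun (b : B) z => f (z, (b : H))) = d := by
      refine hdu _ ?_
      ext b z
      by_cases hz : z ∈ C
      · rw [hΦC _ _ _ hz, ← hF, hf.2 z b]
        obtain ⟨y, hy, hyz, hyu⟩ := hC z
        obtain rfl := hyu z hz rfl
        rw [sum_filter_nsmul_of_transversal hy hyz hyu, add_sub_assoc, add_eq_left, sub_eq_zero]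
        refine Finset.sum_congr rfl fun x hx => ?_
        exact hfc x ((mem_filter_univ _).1 hx).2 b
      · rw [hΦg _ _ _ hz]
        exact (hfc z hz b).symm
    rw [this] at hF
    ext ⟨z, w⟩
    exact congrFun (congrFun hF w) z

theorem hasDistBasis_zmod (n : ℕ) [NeZero n] : HasDistBasis n (ZMod n) := by
  suffices ∀ n : ℕ, ∀ _ : NeZero n, HasDistBasis n (ZMod n) from this n ‹_›
  intro n
  induction n using Nat.recOnPrimePow with
  | zero => exact fun h => absurd rfl h.out
  | one =>
    intro _
    refine ⟨univ, by simp, fun V _ ρ _ c => ⟨fun x => c ⟨x, mem_univ x⟩, ⟨?_, fun _ => rfl⟩, ?_⟩⟩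
    · intro p hp h1
      exact absurd (Nat.dvd_one.1 h1) hp.one_lt.ne'
    · rintro f ⟨-, hf⟩
      ext x
      exact hf ⟨x, mem_univ x⟩
  | prime_pow_mul m p k hp hpm hk ih =>
    intro hn
    obtain ⟨k, rfl⟩ := Nat.exists_eq_succ_of_ne_zero hk.ne'
    have hm : NeZero m := ⟨by rintro rfl; simp at hpm⟩
    have hpk : NeZero (p ^ (k + 1)) := ⟨pow_ne_zero _ hp.ne_zero⟩
    obtain ⟨C, hC0, hCcard, hC⟩ := exists_fibre_transversal (k := k) hp
    exact ((ih hm).prod hp hpm (Nat.card_zmod _) (Nat.card_zmod _) hC0 hCcard hC).of_addEquiv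
      (ZMod.chineseRemainder
        (((hp.coprime_iff_not_dvd).2 hpm).pow_left _)).symm.toAddEquiv

theorem exists_zmod_equiv_nTors (n : ℕ) [NeZero n] :
    ∃ (φ : ZMod n →+ QModZ) (e : ZMod n ≃ nTors n), Function.Injective φ ∧
      ∀ a, (e a : QModZ) = φ a := by
  have hn : (n : ℚ) ≠ 0 := Nat.cast_ne_zero.2 (NeZero.ne n)
  have h0 : ∀ r : ℚ, (r : QModZ) = 0 ↔ ∃ t : ℤ, (t : ℚ) = r := by
    intro r
    rw [QuotientAddGroup.eq_zero_iff, AddSubgroup.mem_zmultiples_iff]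
    simp
  have hu : zmultiplesHom QModZ ((1 / n : ℚ) : QModZ) (n : ℤ) = 0 := by
    rw [zmultiplesHom_apply, ← QuotientAddGroup.mk_zsmul, h0]
    exact ⟨1, by simp [hn]⟩
  let φ : ZMod n →+ QModZ := ZMod.lift n ⟨zmultiplesHom QModZ ((1 / n : ℚ) : QModZ), hu⟩
  have hφ : ∀ t : ℤ, φ (t : ZMod n) = ((t / n : ℚ) : QModZ) := by
    intro t
    simp only [φ, ZMod.lift_coe, zmultiplesHom_apply]
    rw [← QuotientAddGroup.mk_zsmul]
    congr 1
    simp [div_eq_mul_inv]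
  have hinj : Function.Injective φ := by
    rw [injective_iff_map_eq_zero]
    intro a
    obtain ⟨t, rfl⟩ := ZMod.intCast_surjective a
    rw [hφ, h0, ZMod.intCast_zmod_eq_zero_iff_dvd]
    rintro ⟨s, hs⟩
    rw [eq_div_iff hn] at hs
    exact ⟨s, by rw [mul_comm]; exact_mod_cast hs.symm⟩
  have htors : ∀ a, n • φ a = 0 := fun a => by
    rw [← map_nsmul, nsmul_eq_mul, ZMod.natCast_self, zero_mul, map_zero]
  refine ⟨φ, Equiv.ofBijective (fun a => ⟨φ a, htors a⟩) ⟨fun a b h => hinj ?_, ?_⟩, hinj,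
    fun _ => rfl⟩
  · exact congrArg Subtype.val h
  · rintro ⟨x, hx⟩
    obtain ⟨r, rfl⟩ := QuotientAddGroup.mk_surjective x
    rw [← QuotientAddGroup.mk_nsmul, h0] at hx
    obtain ⟨t, ht⟩ := hx
    refine ⟨(t : ZMod n), Subtype.ext ?_⟩
    simp only [hφ]
    rw [ht, nsmul_eq_mul, mul_div_cancel_left₀ _ hn]

theorem ZMod.div_nsmul_eq_zero_iff {n p : ℕ} [NeZero n] (hpn : p ∣ n) (b : ZMod n) :
    (n / p) • b = 0 ↔ ∃ a, p • a = b := by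
  constructor
  · intro h
    obtain ⟨d, rfl⟩ := hpn
    have hd := NeZero.ne (p * d)
    have hp : 0 < p := Nat.pos_of_ne_zero fun h => hd (by simp [h])
    have hd : 0 < d := Nat.pos_of_ne_zero fun h => hd (by simp [h])
    rw [Nat.mul_div_cancel_left _ hp, ← ZMod.natCast_zmod_val b, nsmul_eq_mul, ← Nat.cast_mul,
      ZMod.natCast_eq_zero_iff] at h
    obtain ⟨a, ha⟩ := Nat.dvd_of_mul_dvd_mul_left hd (mul_comm p d ▸ h : d * p ∣ d * b.val)
    refine ⟨(a : ZMod (p * d)), ?_⟩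
    rw [nsmul_eq_mul, ← Nat.cast_mul, ← ha, ZMod.natCast_zmod_val]
  · rintro ⟨a, rfl⟩
    rw [smul_smul, Nat.div_mul_cancel hpn, nsmul_eq_mul, ZMod.natCast_self, zero_mul]

/-- The quotient of `ℤ[X]` is free on the image of `B` as soon as functions on `B` extend
uniquely to functions on `X` that kill the relations. -/
theorem nonempty_quotient_addEquiv {X : Type} (R : AddSubgroup (X →₀ ℤ)) {ι : Type}
    (i : ι → X)
    (h : ∀ (V : Type) [AddCommGroup V] (c : ι → V), ∃! f : X → V,
      R ≤ (Finsupp.linearCombination ℤ f).toAddMonoidHom.ker ∧ ∀ b, f (i b) = c b) :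
    Nonempty (((X →₀ ℤ) ⧸ R) ≃+ (ι →₀ ℤ)) := by
  obtain ⟨f, ⟨hfR, hf⟩, -⟩ := h (ι →₀ ℤ) fun b => Finsupp.single b 1
  let q : X → (X →₀ ℤ) ⧸ R := fun x => QuotientAddGroup.mk' R (Finsupp.single x 1)
  have hq : (Finsupp.linearCombination ℤ q).toAddMonoidHom = QuotientAddGroup.mk' R := by
    ext x
    simp [q]
  let α : ((X →₀ ℤ) ⧸ R) →+ (ι →₀ ℤ) :=
    QuotientAddGroup.lift R (Finsupp.linearCombination ℤ f).toAddMonoidHom hfR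
  let β : (ι →₀ ℤ) →+ ((X →₀ ℤ) ⧸ R) :=
    (Finsupp.linearCombination ℤ fun b => q (i b)).toAddMonoidHom
  have hα : ∀ x, α (q x) = f x := fun x => by simp [α, q]
  have hβ : ∀ b, β (Finsupp.single b 1) = q (i b) := fun b => by simp [β]
  have hβα : ∀ x, β (α (q x)) = q x := by
    have hu := (h _ fun b => q (i b)).unique (y₁ := fun x => β (f x)) (y₂ := q)
      ⟨?_, fun b => by rw [hf, hβ]⟩ ⟨by rw [hq, QuotientAddGroup.ker_mk'], fun _ => rfl⟩
    · intro x
      rw [hα]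
      exact congrFun hu x
    · have : (Finsupp.linearCombination ℤ fun x => β (f x)).toAddMonoidHom =
          β.comp (Finsupp.linearCombination ℤ f).toAddMonoidHom := by
        ext x
        simp
      rw [this]
      intro r hr
      have := hfR hr
      rw [AddMonoidHom.mem_ker] at this ⊢
      rw [AddMonoidHom.comp_apply, this, map_zero]
  have h1 : α.comp β = AddMonoidHom.id _ := by
    ext b : 2
    simp only [AddMonoidHom.comp_apply, Finsupp.singleAddHom_apply, AddMonoidHom.id_apply]
    rw [hβ, hα, hf]
  have h2 : β.comp α = AddMonoidHom.id _ := by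
    refine QuotientAddGroup.addMonoidHom_ext _ ?_
    ext x : 2
    exact hβα x
  exact ⟨AddMonoidHom.toAddEquiv α β h2 h1⟩

/-- Kubert's theorem: let `F` be the free abelian group on `A_n = {x ∈ ℚ/ℤ : n·x = 0}`
and `R ≤ F` the subgroup generated by the distribution relations
`[x] - Σ_{p·y = x} [y]`, for `p` a prime divisor of `n` and `x ∈ ℚ/ℤ` with
`(n/p)·x = 0`.  Then `F/R` (the level-`n` group of the universal ordinary distribution
over `ℚ`) is a free abelian group of rank `φ(n)`; in particular it is torsion-free. -/
theorem stmt_10 (n : ℕ) (hn : 1 ≤ n)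
    (R : AddSubgroup (nTors n →₀ ℤ))
    (hR : R = AddSubgroup.closure
      {f : nTors n →₀ ℤ | ∃ p : ℕ, p.Prime ∧ p ∣ n ∧ ∃ x : nTors n,
        (n / p) • (x : QModZ) = 0 ∧ ∃ S : Finset (nTors n),
          (∀ y : nTors n, y ∈ S ↔ p • (y : QModZ) = (x : QModZ)) ∧
          f = Finsupp.single x 1 - ∑ y ∈ S, Finsupp.single y 1}) :
    Nonempty (((nTors n →₀ ℤ) ⧸ R) ≃+ (Fin (Nat.totient n) →₀ ℤ)) ∧
    ∀ (x : (nTors n →₀ ℤ) ⧸ R) (k : ℤ), k ≠ 0 → k • x = 0 → x = 0 := by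
  have : NeZero n := ⟨by lia⟩
  obtain ⟨φ, e, hφ, he⟩ := exists_zmod_equiv_nTors n
  obtain ⟨B, hB, h⟩ := hasDistBasis_zmod n
  have hfib : ∀ (p : ℕ) (y : nTors n) (a : ZMod n),
      p • (y : QModZ) = e a ↔ p • e.symm y = a := by
    intro p y a
    rw [← e.apply_symm_apply y, he, he, ← map_nsmul, hφ.eq_iff, e.apply_symm_apply]
  have hdiv : ∀ p : ℕ, p ∣ n → ∀ b : ZMod n, (n / p) • (e b : QModZ) = 0 ↔ ∃ a, p • a = b := by
    intro p hp b
    rw [← ZMod.div_nsmul_eq_zero_iff hp, he, ← map_nsmul, map_eq_zero_iff φ hφ]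
  have key : ∀ (V : Type) [AddCommGroup V] (f : nTors n → V),
      R ≤ (Finsupp.linearCombination ℤ f).toAddMonoidHom.ker ↔
        IsTwistedDist n (fun _ => AddMonoidHom.id V) (f ∘ e) := by
    intro V _ f
    rw [hR, AddSubgroup.closure_le]
    have hsum : ∀ (p : ℕ) (a : ZMod n) (S : Finset (nTors n)),
        (∀ y : nTors n, y ∈ S ↔ p • (y : QModZ) = e a) →
          ∑ y ∈ S, f y = ∑ y with p • y = a, f (e y) := by
      intro p a S hS
      refine Finset.sum_equiv e.symm (fun y => ?_) (fun y _ => by simp)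
      rw [hS, hfib, mem_filter_univ]
    constructor
    · intro hk p hp hpn z
      have hS : ∀ y : nTors n, y ∈ ({y | p • y = p • z} : Finset (ZMod n)).map e.toEmbedding ↔
          p • (y : QModZ) = e (p • z) := by
        intro y
        rw [hfib, Finset.mem_map_equiv, mem_filter_univ]
      have := hk ⟨p, hp, hpn, e (p • z), (hdiv p hpn _).2 ⟨z, rfl⟩, _, hS, rfl⟩
      simp only [SetLike.mem_coe, AddMonoidHom.mem_ker, LinearMap.toAddMonoidHom_coe, map_sub,
        map_sum, Finsupp.linearCombination_single, one_smul] at this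
      rw [hsum _ _ _ hS] at this
      exact sub_eq_zero.1 this
    · rintro hd _ ⟨p, hp, hpn, x, hx, S, hS, rfl⟩
      obtain ⟨a, rfl⟩ := e.surjective x
      obtain ⟨z, rfl⟩ := (hdiv p hpn a).1 hx
      simp only [SetLike.mem_coe, AddMonoidHom.mem_ker, LinearMap.toAddMonoidHom_coe, map_sub,
        map_sum, Finsupp.linearCombination_single, one_smul]
      rw [hsum _ _ _ hS, sub_eq_zero]
      exact hd p hp hpn z
  obtain ⟨E⟩ := nonempty_quotient_addEquiv R (fun b : B => e b) (by
    intro V _ c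
    obtain ⟨f, ⟨hf, hfc⟩, hu⟩ := h V (fun _ => AddMonoidHom.id V) (fun _ _ _ => rfl) c
    refine ⟨f ∘ e.symm, ⟨(key V _).2 ?_, fun b => by simpa using hfc b⟩, ?_⟩
    · simpa [Function.comp_assoc] using hf
    · rintro f' ⟨hf', hfc'⟩
      rw [← hu (f' ∘ e) ⟨(key V f').1 hf', hfc'⟩]
      ext x
      simp)
  refine ⟨⟨E.trans (Finsupp.domCongr (B.equivFinOfCardEq hB))⟩, fun x k hk hx => ?_⟩
  have hEx : k • E x = 0 := by rw [← map_zsmul, hx, map_zero]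
  exact (map_eq_zero_iff E E.injective).1 ((smul_eq_zero.1 hEx).resolve_left hk)
end
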